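/- Assume Conditions 1 and 2, and assume that the limit distribution p is nonlattice. Let m_κ (κ ≥ 1) be integers with 1 ≤ m_κ ≤ |n_κ| such that m_κ ∼ a·|n_κ|^{2/3} as κ → ∞ for some constant a > 0. Then N_{m_κ}(𝒯_{n_κ}) converges in distribution to the Poisson distribution Po((2π σ_p² a³)^{−1/2}). -/

import Mathlib

/-!
Common definitions: plane rooted trees, fringe subtree counts, random trees with
a given degree statistic, Poisson/normal limit notions, conditioned Galton–Watson
trees, and sampling without replacement.
-/

open Filter MeasureTheory
open scoped Topology Classical

/-- A plane rooted tree: a root together with a linearly ordered (possibly empty)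
list of subtrees. Structural equality coincides with isomorphism of plane rooted trees. -/
inductive PlaneTree : Type
  | node : List PlaneTree → PlaneTree

namespace PlaneTree

/-- The (out)degree of the root: its number of children. -/
def degree : PlaneTree → ℕ
  | node ts => ts.length

mutual
  /-- The list of all fringe subtrees of a tree (one for each vertex). -/
  def fringe : PlaneTree → List PlaneTree
    | node ts => node ts :: fringeList ts
  def fringeList : List PlaneTree → List PlaneTree
    | [] => []
    | t :: ts => fringe t ++ fringeList ts
end

/-- The number of vertices `|T|` of a plane tree. -/
def size (T : PlaneTree) : ℕ := T.fringe.length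

/-- The degree statistic `n_T` of a tree: `n_T(i)` is the number of vertices with `i` children. -/
noncomputable def degStat (T : PlaneTree) : ℕ →₀ ℕ :=
  Multiset.toFinsupp ((T.fringe.map degree : List ℕ) : Multiset ℕ)

/-- `N_{T'}(T)`: the number of fringe subtrees of `T` equal to `T'`. -/
noncomputable def countTree (T' T : PlaneTree) : ℕ :=
  (T.fringe.filter fun t => decide (t = T')).length

/-- `N_m(T)` for a degree statistic `m`: the number of fringe subtrees of `T`
with degree statistic `m`. -/
noncomputable def countStat (m : ℕ →₀ ℕ) (T : PlaneTree) : ℕ :=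
  (T.fringe.filter fun t => decide (degStat t = m)).length

/-- `N_m(T)` for an integer `m`: the number of fringe subtrees of `T` of size `m`. -/
noncomputable def countSize (m : ℕ) (T : PlaneTree) : ℕ :=
  (T.fringe.filter fun t => decide (size t = m)).length

end PlaneTree

/-- `n : ℕ →₀ ℕ` is a degree statistic: `∑ n(i) = 1 + ∑ i·n(i)`. -/
def IsDegStat (n : ℕ →₀ ℕ) : Prop :=
  (n.sum fun _ c => c) = 1 + n.sum fun i c => i * c

/-- `|n| = ∑_i n(i)`, the size of a degree statistic. -/
def nsize (n : ℕ →₀ ℕ) : ℕ := n.sum fun _ c => c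

/-- The set `𝕋_n` of plane trees with degree statistic `n`. -/
def treesWith (n : ℕ →₀ ℕ) : Set PlaneTree := {T | PlaneTree.degStat T = n}

/-- `|𝕋_n|`, the number of plane trees with degree statistic `n`. -/
noncomputable def numTrees (n : ℕ →₀ ℕ) : ℕ := (treesWith n).ncard

/-- The probability that a uniformly random tree `𝒯_n ∈ 𝕋_n` satisfies `P`. -/
noncomputable def prob (n : ℕ →₀ ℕ) (P : PlaneTree → Prop) : ℝ :=
  (({T ∈ treesWith n | P T}).ncard : ℝ) / (numTrees n : ℝ)

/-- The expectation `E[f(𝒯_n)]` of an `ℕ`-valued functional of the uniformly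
random tree `𝒯_n ∈ 𝕋_n`. -/
noncomputable def expect (n : ℕ →₀ ℕ) (f : PlaneTree → ℕ) : ℝ :=
  ∑' k : ℕ, (k : ℝ) * prob n (fun T => f T = k)

/-- The variance `Var[f(𝒯_n)]`. -/
noncomputable def variance (n : ℕ →₀ ℕ) (f : PlaneTree → ℕ) : ℝ :=
  expect n (fun T => (f T) ^ 2) - (expect n f) ^ 2

/-- The empirical degree distribution `p_i(n) = n(i)/|n|`. -/
noncomputable def empDist (n : ℕ →₀ ℕ) (i : ℕ) : ℝ := (n i : ℝ) / (nsize n : ℝ)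

/-- `π_p(T) = ∏_{i ≥ 0} p_i^{n_T(i)}`. -/
noncomputable def piDist (p : ℕ → ℝ) (T : PlaneTree) : ℝ :=
  (PlaneTree.degStat T).prod fun i c => p i ^ c

/-- `π_p(𝕋_m) = |𝕋_m| · ∏_{i ≥ 0} p_i^{m(i)}`. -/
noncomputable def piSet (p : ℕ → ℝ) (m : ℕ →₀ ℕ) : ℝ :=
  (numTrees m : ℝ) * m.prod fun i c => p i ^ c

/-- Condition 1: the `nseq κ` are degree statistics with `|n_κ| → ∞` and
`p_i(n_κ) → p_i` for every `i`, where `p` is a probability distribution on `ℕ`. -/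
def Condition1 (nseq : ℕ → (ℕ →₀ ℕ)) (p : ℕ → ℝ) : Prop :=
  (∀ κ, IsDegStat (nseq κ)) ∧
  Tendsto (fun κ => nsize (nseq κ)) atTop atTop ∧
  (∀ i, 0 ≤ p i) ∧ HasSum p 1 ∧
  (∀ i, Tendsto (fun κ => empDist (nseq κ) i) atTop (𝓝 (p i)))

/-- Condition 2: in addition, `∑ i² p_i(n_κ) → ∑ i² p_i < ∞`. -/
def Condition2 (nseq : ℕ → (ℕ →₀ ℕ)) (p : ℕ → ℝ) : Prop :=
  Summable (fun i : ℕ => (i : ℝ) ^ 2 * p i) ∧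
  Tendsto (fun κ => ∑' i : ℕ, (i : ℝ) ^ 2 * empDist (nseq κ) i) atTop
    (𝓝 (∑' i : ℕ, (i : ℝ) ^ 2 * p i))

/-- `σ_p² = ∑_{i ≥ 0} (i-1)² p_i`. -/
noncomputable def sigmaSq (p : ℕ → ℝ) : ℝ := ∑' i : ℕ, ((i : ℝ) - 1) ^ 2 * p i

/-- The point probabilities of the Poisson distribution `Po(lam)`. -/
noncomputable def poissonPMF (lam : ℝ) (k : ℕ) : ℝ :=
  Real.exp (-lam) * lam ^ k / (Nat.factorial k : ℝ)

/-- The `q`-th moment of the Poisson distribution `Po(lam)`. -/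
noncomputable def poissonMoment (lam : ℝ) (q : ℕ) : ℝ :=
  ∑' k : ℕ, (k : ℝ) ^ q * poissonPMF lam k

/-- The standard normal cumulative distribution function. -/
noncomputable def stdNormalCDF (x : ℝ) : ℝ :=
  ∫ t in Set.Iic x, Real.exp (-t ^ 2 / 2) / Real.sqrt (2 * Real.pi)

/-- The total variation distance between the law of `f(𝒯_n)` and `Po(lam)`:
`sup_A |P(f(𝒯_n) ∈ A) − Po(lam)(A)|`. -/
noncomputable def dTVPoisson (n : ℕ →₀ ℕ) (f : PlaneTree → ℕ) (lam : ℝ) : ℝ :=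
  ⨆ A : Set ℕ, |prob n (fun T => f T ∈ A) - ∑' k : ℕ, A.indicator (poissonPMF lam) k|

/-- A probability distribution on `ℕ` is nonlattice: the gcd of the differences of
points of its support is `1`. -/
def Nonlattice (p : ℕ → ℝ) : Prop :=
  ∀ h : ℕ, (∀ i j : ℕ, 0 < p i → 0 < p j → (h : ℤ) ∣ (i : ℤ) - (j : ℤ)) → h = 1

/-- The partition function `P(|𝒯_p| = n)` of a Galton–Watson tree with offspring
distribution `p`. -/
noncomputable def gwZ (p : ℕ → ℝ) (n : ℕ) : ℝ :=
  ∑' T : PlaneTree, if PlaneTree.size T = n then piDist p T else 0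

/-- `P(𝒯_{p,n} ∈ {T | P T})` for the conditioned Galton–Watson tree `𝒯_{p,n}`. -/
noncomputable def probGW (p : ℕ → ℝ) (n : ℕ) (P : PlaneTree → Prop) : ℝ :=
  (∑' T : PlaneTree, if PlaneTree.size T = n ∧ P T then piDist p T else 0) / gwZ p n

/-- The expectation `E[f(𝒯_{p,n})]` for an `ℕ`-valued functional. -/
noncomputable def expectGW (p : ℕ → ℝ) (n : ℕ) (f : PlaneTree → ℕ) : ℝ :=
  ∑' k : ℕ, (k : ℝ) * probGW p n (fun T => f T = k)

/-- The filter `n → ∞` along the sizes `n` for which the conditioning `|𝒯_p| = n`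
is well defined. -/
noncomputable def gwFilter (p : ℕ → ℝ) : Filter ℕ :=
  atTop ⊓ Filter.principal {n | 0 < gwZ p n}

/-- A positive function on the positive reals is slowly varying at infinity. -/
def SlowlyVarying (L : ℝ → ℝ) : Prop :=
  (∀ x : ℝ, 0 < x → 0 < L x) ∧
  ∀ c : ℝ, 0 < c → Tendsto (fun x : ℝ => L (c * x) / L x) atTop (𝓝 1)

/-- The probability that a uniformly random permutation of `Fin n` satisfies `P`. -/
noncomputable def probPerm {n : ℕ} (P : Equiv.Perm (Fin n) → Prop) : ℝ :=
  ((Finset.univ.filter P).card : ℝ) / ((Finset.univ : Finset (Equiv.Perm (Fin n))).card : ℝ)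

/-- `S_m = ∑_{i=1}^m d_{τ(i)}`: the sum of `m` of the values `d`, drawn without
replacement via the permutation `τ`. -/
def sampleSum {n : ℕ} (d : Fin n → ℤ) (m : ℕ) (τ : Equiv.Perm (Fin n)) : ℤ :=
  ∑ i : Fin n, if (i : ℕ) < m then d (τ i) else 0

/-- The mean `d̄` of the values `d`. -/
noncomputable def dbar {n : ℕ} (d : Fin n → ℤ) : ℝ := (∑ i : Fin n, (d i : ℝ)) / n

/-- `Q = ∑_i (d_i − d̄)²`. -/
noncomputable def Qval {n : ℕ} (d : Fin n → ℤ) : ℝ := ∑ i : Fin n, ((d i : ℝ) - dbar d) ^ 2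

/-- `σ̂² = (m/n)(1 − m/n) Q`. -/
noncomputable def sigHatSq {n : ℕ} (d : Fin n → ℤ) (m : ℕ) : ℝ :=
  ((m : ℝ) / n) * (1 - (m : ℝ) / n) * Qval d

/-- The empirical frequency `p_k(d) = #{i : d_i = k}/n`. -/
noncomputable def empFreq {n : ℕ} (d : Fin n → ℤ) (k : ℤ) : ℝ :=
  ((Finset.univ.filter (fun i => d i = k)).card : ℝ) / n

/-- The characteristic function `φ_{S_m}(t) = E[exp(i t S_m)]` of the sample sum. -/
noncomputable def charFn {n : ℕ} (d : Fin n → ℤ) (m : ℕ) (t : ℝ) : ℂ :=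
  (Fintype.card (Equiv.Perm (Fin n)) : ℂ)⁻¹ *
    ∑ τ : Equiv.Perm (Fin n), Complex.exp (Complex.I * t * (sampleSum d m τ : ℂ))

/-- A probability distribution on `ℤ` is nonlattice. -/
def NonlatticeZ (p : ℤ → ℝ) : Prop :=
  ∀ h : ℕ, (∀ i j : ℤ, 0 < p i → 0 < p j → (h : ℤ) ∣ i - j) → h = 1

/-- Bonferroni's inequalities: truncating the inclusion-exclusion series for `{y = k}`. -/
theorem abs_indicator_sub_bonferroni_le (y k R : ℕ) :
    |(if y = k then (1 : ℝ) else 0) - ∑ i ∈ Finset.range (R + 1),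
        (-1) ^ i * (y.descFactorial (k + i) : ℝ) / (k.factorial * i.factorial)| ≤
      (y.descFactorial (k + (R + 1)) : ℝ) / (k.factorial * (R + 1).factorial) := by
  have key : ∀ i : ℕ, (y.descFactorial (k + i) : ℝ) / (k.factorial * i.factorial) =
      (y.choose k : ℝ) * ((y - k).choose i : ℝ) := by
    intro i
    have h := Nat.descFactorial_mul_descFactorial (n := y) (Nat.le_add_right k i)
    rw [Nat.add_sub_cancel_left, Nat.descFactorial_eq_factorial_mul_choose (y - k),
      Nat.descFactorial_eq_factorial_mul_choose y k] at h
    rw [← h]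
    have := Nat.factorial_ne_zero k
    have := Nat.factorial_ne_zero i
    push_cast
    field_simp
  have hs : ∑ i ∈ Finset.range (R + 1),
        (-1) ^ i * (y.descFactorial (k + i) : ℝ) / (k.factorial * i.factorial) =
      (y.choose k : ℝ) * ∑ i ∈ Finset.range (R + 1), (-1) ^ i * ((y - k).choose i : ℝ) := by
    rw [Finset.mul_sum]
    refine Finset.sum_congr rfl fun i _ => ?_
    rw [mul_div_assoc, key]
    ring
  rw [hs, key]
  rcases lt_trichotomy y k with h | h | h
  · simp [Nat.choose_eq_zero_of_lt h, h.ne]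
  · subst h
    rw [Finset.sum_range_succ']
    simp
  · obtain ⟨M, hM⟩ : ∃ M, y - k = M + 1 := ⟨y - k - 1, by omega⟩
    have halt : ∑ i ∈ Finset.range (R + 1), (-1 : ℝ) ^ i * ((M + 1).choose i : ℝ) =
        (-1) ^ R * (M.choose R : ℝ) := by
      have := Int.alternating_sum_range_choose_eq_choose (n := M) (m := R)
      have := congrArg (fun z : ℤ => (z : ℝ)) this
      simpa using this
    rw [hM, halt, if_neg h.ne', zero_sub, abs_neg, abs_mul, abs_mul, abs_pow, abs_neg, abs_one,
      one_pow, one_mul, Nat.abs_cast, Nat.abs_cast]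
    refine mul_le_mul_of_nonneg_left ?_ (Nat.cast_nonneg _)
    rw [Nat.choose_succ_succ]
    exact_mod_cast Nat.le_add_right _ _

/-- The method of factorial moments for Poisson convergence. -/
theorem tendsto_poisson_of_factorial_moments {Ω : ℕ → Type*} [∀ κ, Fintype (Ω κ)]
    (Y : ∀ κ, Ω κ → ℕ) (lam : ℝ)
    (h : ∀ q : ℕ, Tendsto (fun κ => (∑ ω, ((Y κ ω).descFactorial q : ℝ)) / Fintype.card (Ω κ))
      atTop (𝓝 (lam ^ q))) (k : ℕ) :
    Tendsto (fun κ => ((Finset.univ.filter fun ω => Y κ ω = k).card : ℝ) / Fintype.card (Ω κ))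
      atTop (𝓝 (poissonPMF lam k)) := by
  set B : ℕ → ℕ → ℝ := fun q κ => (∑ ω, ((Y κ ω).descFactorial q : ℝ)) / Fintype.card (Ω κ)
    with hB
  have hbound : ∀ R, ∀ κ, |((Finset.univ.filter fun ω => Y κ ω = k).card : ℝ) / Fintype.card (Ω κ)
      - ∑ i ∈ Finset.range (R + 1), (-1) ^ i * B (k + i) κ / (k.factorial * i.factorial)| ≤
      B (k + (R + 1)) κ / (k.factorial * (R + 1).factorial) := by
    intro R κ
    have e1 : ((Finset.univ.filter fun ω => Y κ ω = k).card : ℝ) / Fintype.card (Ω κ)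
      - ∑ i ∈ Finset.range (R + 1), (-1) ^ i * B (k + i) κ / (k.factorial * i.factorial) =
      (∑ ω, ((if Y κ ω = k then (1 : ℝ) else 0) - ∑ i ∈ Finset.range (R + 1),
        (-1) ^ i * ((Y κ ω).descFactorial (k + i) : ℝ) / (k.factorial * i.factorial))) /
        Fintype.card (Ω κ) := by
      rw [Finset.sum_sub_distrib, sub_div, Finset.sum_comm]
      congr 1
      · simp
      · rw [Finset.sum_div]
        refine Finset.sum_congr rfl fun i _ => ?_
        rw [← Finset.sum_div, ← Finset.mul_sum]
        ring
    have e2 : B (k + (R + 1)) κ / (k.factorial * (R + 1).factorial) =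
      (∑ ω, ((Y κ ω).descFactorial (k + (R + 1)) : ℝ) / (k.factorial * (R + 1).factorial)) /
        Fintype.card (Ω κ) := by
      rw [← Finset.sum_div]
      ring
    rw [e1, e2, abs_div, Nat.abs_cast]
    gcongr
    exact (Finset.abs_sum_le_sum_abs _ _).trans
      (Finset.sum_le_sum fun ω _ => abs_indicator_sub_bonferroni_le _ _ _)
  have hexp : Tendsto (fun R => ∑ i ∈ Finset.range (R + 1),
      (-1) ^ i * lam ^ (k + i) / (k.factorial * i.factorial)) atTop (𝓝 (poissonPMF lam k)) := by
    have h1 : HasSum (fun i : ℕ => (-lam) ^ i / i.factorial) (Real.exp (-lam)) := by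
      rw [Real.exp_eq_exp_ℝ]
      exact NormedSpace.expSeries_div_hasSum_exp (-lam)
    have h2 := (h1.mul_left (lam ^ k / k.factorial)).tendsto_sum_nat
    have h3 := h2.comp (tendsto_add_atTop_nat 1)
    convert h3 using 2
    · refine Finset.sum_congr rfl fun i _ => ?_
      have := Nat.factorial_ne_zero k
      have := Nat.factorial_ne_zero i
      rw [neg_pow]
      field_simp
      ring
    · unfold poissonPMF
      ring
  have hrem : Tendsto (fun R : ℕ => lam ^ (k + (R + 1)) / (k.factorial * (R + 1).factorial)) atTop
      (𝓝 0) := by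
    have h1 := ((FloorSemiring.tendsto_pow_div_factorial_atTop lam).comp
      (tendsto_add_atTop_nat 1)).const_mul (lam ^ k / k.factorial)
    rw [mul_zero] at h1
    convert h1 using 2 with R
    have := Nat.factorial_ne_zero k
    have := Nat.factorial_ne_zero (R + 1)
    simp only [Function.comp]
    field_simp
    ring
  rw [Metric.tendsto_atTop]
  intro ε hε
  obtain ⟨R, hR1, hR2⟩ := (((Metric.tendsto_nhds.mp hexp) (ε / 3) (by positivity)).and
    ((Metric.tendsto_nhds.mp hrem) (ε / 3) (by positivity))).exists
  have hsum : Tendsto (fun κ => ∑ i ∈ Finset.range (R + 1),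
      (-1) ^ i * B (k + i) κ / (k.factorial * i.factorial)) atTop
      (𝓝 (∑ i ∈ Finset.range (R + 1), (-1) ^ i * lam ^ (k + i) / (k.factorial * i.factorial))) :=
    tendsto_finsetSum _ fun i _ => ((h (k + i)).const_mul _).div_const _
  have hlast := (h (k + (R + 1))).div_const ((k.factorial : ℝ) * (R + 1).factorial)
  have hev := ((Metric.tendsto_nhds.mp hsum) (ε / 3) (by positivity)).and
    (hlast.eventually_lt_const (lt_of_abs_lt (by rwa [Real.dist_eq, sub_zero] at hR2)))
  obtain ⟨K, hK⟩ := eventually_atTop.mp hev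
  refine ⟨K, fun κ hκ => ?_⟩
  obtain ⟨a1, a2⟩ := hK κ hκ
  have a3 := hbound R κ
  rw [Real.dist_eq] at *
  rw [abs_lt] at *
  rw [abs_le] at a3
  constructor <;> linarith [a3.1, a3.2, a1.1, a1.2, hR1.1, hR1.2]

namespace PlaneTree

/-- The sum of the steps `d - 1` over a word of outdegrees. -/
def stepSum (w : List ℕ) : ℤ := (w.map fun d => (d : ℤ) - 1).sum

@[simp] theorem stepSum_nil : stepSum [] = 0 := rfl

@[simp] theorem stepSum_cons (d : ℕ) (w : List ℕ) :
    stepSum (d :: w) = ((d : ℤ) - 1) + stepSum w := by simp [stepSum]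

/-- A Łukasiewicz word: the steps sum to `-1` and all proper prefixes have nonnegative sum. -/
def ExcWord (w : List ℕ) : Prop :=
  stepSum w = -1 ∧ ∀ j < w.length, 0 ≤ stepSum (w.take j)

/-- The preorder word of outdegrees of a forest. -/
def forestCode (ts : List PlaneTree) : List ℕ := (fringeList ts).map degree

/-- The preorder word of outdegrees of a tree. -/
def code (T : PlaneTree) : List ℕ := T.fringe.map degree

theorem fringeList_append (us ts : List PlaneTree) :
    fringeList (us ++ ts) = fringeList us ++ fringeList ts := by
  induction us with
  | nil => simp [fringeList]
  | cons u us ih => simp [fringeList, ih]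

theorem fringeList_node_cons (us ts : List PlaneTree) :
    fringeList (node us :: ts) = node us :: fringeList (us ++ ts) := by
  rw [fringeList_append]
  simp [fringeList, fringe]

@[simp] theorem forestCode_nil : forestCode [] = [] := by simp [forestCode, fringeList]

theorem forestCode_node_cons (us ts : List PlaneTree) :
    forestCode (node us :: ts) = us.length :: forestCode (us ++ ts) := by
  simp [forestCode, fringeList_node_cons, degree]

theorem forestCode_append (us ts : List PlaneTree) :
    forestCode (us ++ ts) = forestCode us ++ forestCode ts := by
  simp [forestCode, fringeList_append]

theorem forestCode_singleton (T : PlaneTree) : forestCode [T] = code T := by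
  simp [forestCode, code, fringeList]

theorem length_code (T : PlaneTree) : (code T).length = size T := by simp [code, size]

/-- Induction on forests along the preorder traversal. -/
theorem forest_induction {P : List PlaneTree → Prop} (nil : P [])
    (node_cons : ∀ us ts, P (us ++ ts) → P (node us :: ts)) (ts : List PlaneTree) : P ts := by
  induction h : (forestCode ts).length generalizing ts with
  | zero =>
    cases ts with
    | nil => exact nil
    | cons t ts => cases t; simp [forestCode_node_cons] at h
  | succ n ih =>
    cases ts with
    | nil => exact nil
    | cons t ts =>
      cases t with
      | node us => exact node_cons us ts (ih _ (by simpa [forestCode_node_cons] using h))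

theorem stepSum_forestCode (ts : List PlaneTree) : stepSum (forestCode ts) = -(ts.length : ℤ) := by
  induction ts using forest_induction with
  | nil => simp
  | node_cons us ts ih =>
    rw [forestCode_node_cons, stepSum_cons, ih, List.length_append, List.length_cons]
    push_cast
    ring

theorem lt_stepSum_take_forestCode (ts : List PlaneTree) :
    ∀ j < (forestCode ts).length, -(ts.length : ℤ) < stepSum ((forestCode ts).take j) := by
  induction ts using forest_induction with
  | nil => simp
  | node_cons us ts ih =>
    rw [forestCode_node_cons]
    intro j hj
    cases j with
    | zero => simp; omega
    | succ j =>
      have := ih j (by simpa using hj)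
      simp only [List.take_succ_cons, stepSum_cons, List.length_cons, List.length_append] at *
      push_cast at *
      linarith

theorem forestCode_injective : Function.Injective forestCode := by
  intro ts
  induction ts using forest_induction with
  | nil =>
    intro ts' h
    cases ts' with
    | nil => rfl
    | cons t ts' => cases t; simp [forestCode_node_cons] at h
  | node_cons us ts ih =>
    intro ts' h
    cases ts' with
    | nil => simp [forestCode_node_cons] at h
    | cons t ts' =>
      cases t with
      | node us' =>
        rw [forestCode_node_cons, forestCode_node_cons, List.cons.injEq] at h
        obtain ⟨rfl, rfl⟩ := List.append_inj (ih h.2) h.1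
        rfl

theorem code_injective : Function.Injective code := by
  intro T T' h
  rw [← forestCode_singleton, ← forestCode_singleton] at h
  simpa using forestCode_injective h

theorem exists_forestCode (w : List ℕ) (k : ℕ) (hw : stepSum w = -(k : ℤ))
    (hpre : ∀ j < w.length, -(k : ℤ) < stepSum (w.take j)) :
    ∃ ts : List PlaneTree, ts.length = k ∧ forestCode ts = w := by
  induction w generalizing k with
  | nil =>
    refine ⟨[], ?_, by simp⟩
    simp at hw
    simp [hw]
  | cons d w ih =>
    have hk : 0 < k := by simpa using hpre 0 (by simp)
    obtain ⟨k, rfl⟩ : ∃ k', k = k' + 1 := ⟨k - 1, by omega⟩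
    obtain ⟨ts, hts, hcode⟩ := ih (d + k)
      (by rw [stepSum_cons] at hw; push_cast at *; linarith)
      (fun j hj => by
        have := hpre (j + 1) (by simpa using hj)
        rw [List.take_succ_cons, stepSum_cons] at this
        push_cast at *
        linarith)
    refine ⟨node (ts.take d) :: ts.drop d, by simp [hts], ?_⟩
    rw [forestCode_node_cons, List.take_append_drop, hcode]
    simp [hts]

theorem excWord_code (T : PlaneTree) : ExcWord (code T) := by
  rw [← forestCode_singleton]
  refine ⟨by simpa using stepSum_forestCode [T], fun j hj => ?_⟩
  have := lt_stepSum_take_forestCode [T] j hj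
  simp at this
  omega

theorem ExcWord.exists_code {w : List ℕ} (hw : ExcWord w) : ∃ T, code T = w := by
  obtain ⟨ts, hts, rfl⟩ := exists_forestCode w 1 (by simpa using hw.1)
    (fun j hj => by have := hw.2 j hj; push_cast; omega)
  obtain ⟨T, rfl⟩ := List.length_eq_one_iff.mp hts
  exact ⟨T, (forestCode_singleton T).symm⟩

/-- A word has at most one prefix that is a Łukasiewicz word. -/
theorem excWord_take_append_iff {u v : List ℕ} (hu : ExcWord u) (m : ℕ) :
    (m ≤ (u ++ v).length ∧ ExcWord ((u ++ v).take m)) ↔ u.length = m := by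
  constructor
  · rintro ⟨hm, h1, h2⟩
    rcases lt_trichotomy m u.length with h | h | h
    · rw [List.take_append_of_le_length h.le] at h1
      have := hu.2 m h
      omega
    · exact h.symm
    · have := h2 u.length (by rw [List.length_take]; omega)
      rw [List.take_take, min_eq_left h.le, List.take_left, hu.1] at this
      omega
  · rintro rfl
    rw [List.take_left]
    exact ⟨by simp, hu⟩

/-- The number of occurrences of Łukasiewicz words of length `m` in a word. -/
noncomputable def windowCount (m : ℕ) (w : List ℕ) : ℕ :=
  ∑ i ∈ Finset.range w.length,
    if i + m ≤ w.length ∧ ExcWord ((w.drop i).take m) then 1 else 0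

theorem windowCount_cons (m d : ℕ) (w : List ℕ) :
    windowCount m (d :: w) = windowCount m w +
      if m ≤ (d :: w).length ∧ ExcWord ((d :: w).take m) then 1 else 0 := by
  rw [windowCount, List.length_cons, Finset.sum_range_succ']
  congr 1
  · refine Finset.sum_congr rfl fun i _ => ?_
    rw [List.drop_succ_cons]
    congr 1
    simp only [eq_iff_iff, and_congr_left_iff]
    intro _
    omega
  · simp

theorem windowCount_forestCode (m : ℕ) (ts : List PlaneTree) :
    windowCount m (forestCode ts) =
      ((fringeList ts).filter fun t => decide (size t = m)).length := by
  induction ts using forest_induction with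
  | nil => simp [windowCount, fringeList]
  | node_cons us ts ih =>
    have h1 : forestCode (node us :: ts) = code (node us) ++ forestCode ts := by
      rw [← forestCode_singleton, ← forestCode_append, List.singleton_append]
    have h2 := excWord_take_append_iff (v := forestCode ts) (excWord_code (node us)) m
    rw [← h1, length_code, forestCode_node_cons] at h2
    rw [fringeList_node_cons, forestCode_node_cons, windowCount_cons, ih, List.filter_cons]
    simp only [h2]
    split_ifs <;> simp_all

theorem countSize_eq_windowCount (m : ℕ) (T : PlaneTree) :
    countSize m T = windowCount m (code T) := by
  rw [← forestCode_singleton, windowCount_forestCode]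
  simp [countSize, fringeList]

end PlaneTree

/-- The first `m` steps of `g` sum to `-1`, and all shorter partial sums are nonnegative. -/
def IsExcursion (g : ℕ → ℤ) (m : ℕ) : Prop :=
  ∑ b ∈ Finset.range m, g b = -1 ∧ ∀ j < m, 0 ≤ ∑ b ∈ Finset.range j, g b

/-- Excursions of the same length cannot overlap properly. -/
theorem IsExcursion.not_overlap {g : ℕ → ℤ} {m c : ℕ} (h : IsExcursion g m) (hc : 0 < c)
    (hcm : c < m) : ¬ IsExcursion (fun b => g (c + b)) m := by
  intro h'
  have h1 := h.2 c hcm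
  have h2 := h.1
  have h3 : 0 ≤ ∑ b ∈ Finset.range (m - c), g (c + b) := h'.2 (m - c) (by omega)
  have h4 := Finset.sum_range_add g c (m - c)
  rw [Nat.add_sub_cancel' hcm.le] at h4
  omega

theorem sum_zmod_eq_sum_range {m : ℕ} [NeZero m] {M : Type*} [AddCommMonoid M] (h : ZMod m → M) :
    ∑ b, h b = ∑ b ∈ Finset.range m, h (b : ZMod m) := by
  refine Finset.sum_bij' (fun a _ => a.val) (fun b _ => (b : ZMod m)) ?_ ?_ ?_ ?_ ?_
  · intro a _
    exact Finset.mem_range.mpr (ZMod.val_lt a)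
  · simp
  · simp
  · intro b hb
    exact ZMod.val_cast_of_lt (Finset.mem_range.mp hb)
  · simp

/-- The cycle lemma: exactly one rotation of a cyclic sequence with sum `-1` is an excursion. -/
theorem card_rotations_isExcursion {m : ℕ} [NeZero m] (h : ZMod m → ℤ) (hsum : ∑ b, h b = -1) :
    (Finset.univ.filter fun r : ZMod m => IsExcursion (fun b => h (r + b)) m).card = 1 := by
  set S : ℕ → ℤ := fun k => ∑ b ∈ Finset.range k, h (b : ZMod m) with hS
  have hpart : ∀ k j : ℕ, ∑ b ∈ Finset.range j, h ((k : ZMod m) + b) = S (k + j) - S k := by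
    intro k j
    rw [hS]
    simp only
    rw [Finset.sum_range_add]
    push_cast
    ring
  have hper : ∀ k, S (k + m) = S k - 1 := by
    intro k
    rw [add_comm, hS]
    simp only
    rw [Finset.sum_range_add, ← sum_zmod_eq_sum_range, hsum]
    simp
    ring
  have hiff : ∀ k : ℕ, IsExcursion (fun b => h ((k : ZMod m) + b)) m ↔
      ∀ j < m, S k ≤ S (k + j) := by
    intro k
    unfold IsExcursion
    simp only [hpart, hper]
    simp
  have hm : 0 < m := NeZero.pos m
  obtain ⟨k, hk, hmin⟩ : ∃ k ∈ Finset.Icc 1 m, ∀ j ∈ Finset.Icc 1 m,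
      S k ≤ S j ∧ (j < k → S k < S j) := by
    have hex : ∃ k, k ∈ Finset.Icc 1 m ∧ ∀ j ∈ Finset.Icc 1 m, S k ≤ S j :=
      Finset.exists_min_image _ S ⟨1, by simp; omega⟩
    refine ⟨Nat.find hex, (Nat.find_spec hex).1, fun j hj => ⟨(Nat.find_spec hex).2 j hj, ?_⟩⟩
    intro hlt
    refine lt_of_le_of_ne ((Nat.find_spec hex).2 j hj) fun heq => ?_
    exact Nat.find_min hex hlt ⟨hj, fun i hi => heq ▸ (Nat.find_spec hex).2 i hi⟩
  rw [Finset.mem_Icc] at hk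
  rw [Finset.card_eq_one]
  refine ⟨(k : ZMod m), ?_⟩
  have hexk : IsExcursion (fun b => h ((k : ZMod m) + b)) m := by
    rw [hiff]
    intro j hj
    by_cases hkj : k + j ≤ m
    · exact (hmin _ (by rw [Finset.mem_Icc]; omega)).1
    · have h1 := hper (k + j - m)
      rw [Nat.sub_add_cancel (by omega)] at h1
      have h2 := (hmin (k + j - m) (by rw [Finset.mem_Icc]; omega)).2 (by omega)
      omega
  have huniq : ∀ k₁ k₂ : ℕ, k₁ < k₂ → k₂ < m → IsExcursion (fun b => h ((k₁ : ZMod m) + b)) m →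
      ¬ IsExcursion (fun b => h ((k₂ : ZMod m) + b)) m := by
    intro k₁ k₂ h12 h2m h1 h2
    rw [hiff] at h1 h2
    have a1 := h1 (k₂ - k₁) (by omega)
    have a2 := h2 (k₁ + m - k₂) (by omega)
    rw [Nat.add_sub_cancel' (by omega)] at a1 a2
    rw [hper] at a2
    omega
  ext r
  simp only [Finset.mem_filter, Finset.mem_univ, true_and, Finset.mem_singleton]
  constructor
  · intro hr
    rw [← ZMod.natCast_zmod_val r] at hr
    rw [← ZMod.natCast_zmod_val (k : ZMod m)] at hexk
    rcases lt_trichotomy r.val (k : ZMod m).val with hlt | heq | hlt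
    · exact absurd hexk (huniq _ _ hlt (ZMod.val_lt _) hr)
    · exact ZMod.val_injective m heq
    · exact absurd hr (huniq _ _ hlt (ZMod.val_lt _) hexk)
  · rintro rfl
    exact hexk

/-- The number of cyclic windows of length `m` of `f` that are excursions. -/
noncomputable def cyclicCount {N : ℕ} [NeZero N] (m : ℕ) (f : ZMod N → ℤ) : ℕ :=
  (Finset.univ.filter fun i : ZMod N => IsExcursion (fun b => f (i + b)) m).card

theorem cyclicCount_rotate {N : ℕ} [NeZero N] (m : ℕ) (f : ZMod N → ℤ) (r : ZMod N) :
    cyclicCount m (fun i => f (r + i)) = cyclicCount m f := by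
  refine Finset.card_bij (fun i _ => r + i) ?_ ?_ ?_
  · intro i hi
    simpa [add_assoc] using hi
  · intro i _ j _ h
    simpa using h
  · intro j hj
    refine ⟨j - r, ?_, by simp⟩
    simpa [← add_assoc] using hj

/-- Among all arrangements of values with total `-1`, being an excursion is independent of any
rotation invariant event, and has probability `1 / N`. -/
theorem card_mul_card_excursion_arrangements {N : ℕ} [NeZero N] (x : ZMod N → ℤ)
    (hx : ∑ i, x i = -1) (P : (ZMod N → ℤ) → Prop)
    (hP : ∀ f r, P (fun i => f (r + i)) ↔ P f) :
    N * (Finset.univ.filter fun σ : Equiv.Perm (ZMod N) =>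
      IsExcursion (fun b => x (σ b)) N ∧ P (x ∘ σ)).card =
    (Finset.univ.filter fun σ : Equiv.Perm (ZMod N) => P (x ∘ σ)).card := by
  have h1 : ∀ r : ZMod N, (Finset.univ.filter fun σ : Equiv.Perm (ZMod N) =>
      IsExcursion (fun b => x (σ (r + b))) N ∧ P (x ∘ σ)).card =
      (Finset.univ.filter fun σ : Equiv.Perm (ZMod N) =>
        IsExcursion (fun b => x (σ b)) N ∧ P (x ∘ σ)).card := by
    intro r
    refine Finset.card_bij (fun σ _ => (Equiv.addLeft r).trans σ) ?_ ?_ ?_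
    · intro σ hσ
      simp only [Finset.mem_filter, Finset.mem_univ, true_and] at hσ ⊢
      exact ⟨hσ.1, (hP (x ∘ σ) r).mpr hσ.2⟩
    · intro σ _ τ _ h
      ext i
      have := Equiv.congr_fun h (-r + i)
      simpa using this
    · intro σ hσ
      refine ⟨(Equiv.addLeft (-r)).trans σ, ?_, ?_⟩
      · simp only [Finset.mem_filter, Finset.mem_univ, true_and] at hσ ⊢
        refine ⟨by simpa using hσ.1, ?_⟩
        exact (hP (x ∘ σ) (-r)).mpr hσ.2
      · ext i
        simp
  have h2 : ∑ r : ZMod N, (Finset.univ.filter fun σ : Equiv.Perm (ZMod N) =>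
      IsExcursion (fun b => x (σ (r + b))) N ∧ P (x ∘ σ)).card =
      (Finset.univ.filter fun σ : Equiv.Perm (ZMod N) => P (x ∘ σ)).card := by
    simp only [Finset.card_filter]
    rw [Finset.sum_comm]
    refine Finset.sum_congr rfl fun σ _ => ?_
    by_cases hσ : P (x ∘ σ)
    · simp only [hσ, and_true, if_true]
      rw [← Finset.card_filter]
      exact card_rotations_isExcursion (x ∘ σ) ((Equiv.sum_comp σ x).trans hx)
    · simp [hσ]
  rw [← h2, Finset.sum_congr rfl fun r _ => h1 r]
  simp [ZMod.card]

namespace PlaneTree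

/-- The word read off a cyclic arrangement, starting from position `0`. -/
def wordOf {N : ℕ} (f : ZMod N → ℕ) : List ℕ := (List.range N).map fun i : ℕ => f (i : ZMod N)

@[simp] theorem length_wordOf {N : ℕ} (f : ZMod N → ℕ) : (wordOf f).length = N := by
  simp [wordOf]

theorem coe_wordOf {N : ℕ} [NeZero N] (f : ZMod N → ℕ) :
    (wordOf f : Multiset ℕ) = Finset.univ.val.map f := by
  have h : (Finset.univ : Finset (ZMod N)) = (Finset.range N).image fun i : ℕ => (i : ZMod N) := by
    ext a
    simp only [Finset.mem_univ, Finset.mem_image, Finset.mem_range, true_iff]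
    exact ⟨a.val, ZMod.val_lt a, ZMod.natCast_zmod_val a⟩
  rw [h, Finset.image_val_of_injOn]
  · rw [Finset.range_val, ← Multiset.coe_range, Multiset.map_map]
    rfl
  · intro a ha b hb hab
    have := congrArg ZMod.val hab
    rwa [ZMod.val_cast_of_lt (by simpa using ha), ZMod.val_cast_of_lt (by simpa using hb)] at this

theorem stepSum_append (u v : List ℕ) : stepSum (u ++ v) = stepSum u + stepSum v := by
  simp [stepSum]

theorem stepSum_take_drop_wordOf {N : ℕ} (f : ZMod N → ℕ) (i j : ℕ) (h : i + j ≤ N) :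
    stepSum (((wordOf f).drop i).take j) =
      ∑ b ∈ Finset.range j, ((f ((i : ZMod N) + b) : ℤ) - 1) := by
  induction j with
  | zero => simp
  | succ j ih =>
    rw [List.take_succ_eq_append_getElem (by simp; omega), stepSum_append, ih (by omega),
      Finset.sum_range_succ]
    simp [wordOf]

theorem excWord_take_drop_wordOf {N : ℕ} (f : ZMod N → ℕ) (i m : ℕ) (h : i + m ≤ N) :
    ExcWord (((wordOf f).drop i).take m) ↔
      IsExcursion (fun b => (f ((i : ZMod N) + b) : ℤ) - 1) m := by
  unfold ExcWord IsExcursion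
  rw [stepSum_take_drop_wordOf f i m h]
  have hl : (((wordOf f).drop i).take m).length = m := by simp; omega
  rw [hl]
  refine and_congr_right fun _ => forall₂_congr fun j hj => ?_
  rw [List.take_take, min_eq_left hj.le, stepSum_take_drop_wordOf f i j (by omega)]

theorem excWord_wordOf {N : ℕ} (f : ZMod N → ℕ) :
    ExcWord (wordOf f) ↔ IsExcursion (fun b => (f b : ℤ) - 1) N := by
  have := excWord_take_drop_wordOf f 0 N (by simp)
  rw [List.drop_zero, List.take_of_length_le (by simp)] at this
  simpa using this

theorem windowCount_wordOf {N : ℕ} [NeZero N] (f : ZMod N → ℕ) (m : ℕ)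
    (hf : ExcWord (wordOf f)) :
    windowCount m (wordOf f) = cyclicCount m fun i => (f i : ℤ) - 1 := by
  rw [excWord_wordOf] at hf
  rw [windowCount, cyclicCount, Finset.card_filter, sum_zmod_eq_sum_range, length_wordOf]
  refine Finset.sum_congr rfl fun i hi => ?_
  rw [Finset.mem_range] at hi
  refine if_congr ?_ rfl rfl
  by_cases h : i + m ≤ N
  · rw [excWord_take_drop_wordOf f i m h]
    simp [h]
  · simp only [h, false_and, false_iff]
    intro hexc
    have h1 := hexc.2 (N - i) (by omega)
    have h2 := hf.2 i hi
    have h3 := hf.1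
    have h4 := Finset.sum_range_add (fun b : ℕ => (f (b : ZMod N) : ℤ) - 1) i (N - i)
    rw [Nat.add_sub_cancel' hi.le] at h4
    push_cast at h4
    linarith

/-- Two families with the same multiset of values differ by a permutation. -/
theorem exists_perm_of_map_univ_eq {α β : Type*} [Fintype α] (f g : α → β)
    (h : Finset.univ.val.map f = Finset.univ.val.map g) : ∃ σ : Equiv.Perm α, g ∘ σ = f := by
  have hc : ∀ c, Nonempty ({a // f a = c} ≃ {a // g a = c}) := by
    intro c
    refine ⟨Fintype.equivOfCardEq ?_⟩
    have := congrArg (Multiset.count c) h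
    rw [Multiset.count_map, Multiset.count_map] at this
    rw [Fintype.card_subtype, Fintype.card_subtype, Finset.card_def, Finset.card_def,
      Finset.filter_val, Finset.filter_val]
    simpa only [eq_comm] using this
  exact ⟨Equiv.ofFiberEquiv fun c => (hc c).some, funext fun a => Equiv.ofFiberEquiv_map _ a⟩

/-- All words obtained by arranging the values of `d`. -/
noncomputable def arrangementWords {N : ℕ} [NeZero N] (d : ZMod N → ℕ) : Finset (List ℕ) :=
  Finset.univ.image fun σ : Equiv.Perm (ZMod N) => wordOf (d ∘ σ)

theorem wordOf_injective {N : ℕ} [NeZero N] :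
    Function.Injective (wordOf : (ZMod N → ℕ) → List ℕ) := by
  intro f g h
  unfold wordOf at h
  rw [List.map_inj_left] at h
  ext i
  have := h i.val (by simpa using ZMod.val_lt i)
  simpa using this

theorem mem_arrangementWords {N : ℕ} [NeZero N] (d : ZMod N → ℕ) (w : List ℕ) :
    w ∈ arrangementWords d ↔ (w : Multiset ℕ) = Finset.univ.val.map d := by
  constructor
  · intro h
    obtain ⟨σ, -, rfl⟩ := Finset.mem_image.mp h
    rw [coe_wordOf, ← Multiset.map_map, Multiset.map_univ_val_equiv]
  · intro h
    have hl : w.length = N := by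
      have := congrArg Multiset.card h
      simpa [ZMod.card] using this
    have hw : w = wordOf fun i : ZMod N => w.getD i.val 0 := by
      refine List.ext_getElem (by simp [hl]) fun i h1 h2 => ?_
      have hi : i < N := hl ▸ h1
      simp [wordOf, Nat.mod_eq_of_lt hi, h1]
    rw [hw, coe_wordOf] at h
    obtain ⟨σ, hσ⟩ := exists_perm_of_map_univ_eq _ _ h
    rw [arrangementWords, Finset.mem_image]
    exact ⟨σ, Finset.mem_univ _, by rw [hσ, ← hw]⟩

theorem ncard_treesWith {N : ℕ} [NeZero N] (n : ℕ →₀ ℕ) (d : ZMod N → ℕ)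
    (hd : Finset.univ.val.map d = Finsupp.toMultiset n) (Q : List ℕ → Prop) :
    ({T ∈ treesWith n | Q (code T)}).ncard =
      ((arrangementWords d).filter fun w => ExcWord w ∧ Q w).card := by
  rw [← Set.ncard_image_of_injective _ code_injective, ← Set.ncard_coe_finset]
  congr 1
  have hdeg : ∀ T, T ∈ treesWith n ↔ code T ∈ arrangementWords d := by
    intro T
    rw [mem_arrangementWords, hd]
    change Multiset.toFinsupp ((code T : List ℕ) : Multiset ℕ) = n ↔ _
    rw [← Multiset.toFinsupp_symm_apply]
    exact (Multiset.toFinsupp.toEquiv.eq_symm_apply).symm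
  ext w
  simp only [Set.mem_image, Set.mem_ofPred_eq, Finset.coe_filter, hdeg]
  constructor
  · rintro ⟨T, ⟨h1, h2⟩, rfl⟩
    exact ⟨h1, excWord_code T, h2⟩
  · rintro ⟨h1, h2, h3⟩
    obtain ⟨T, rfl⟩ := h2.exists_code
    exact ⟨T, ⟨h1, h3⟩, rfl⟩

theorem card_filter_perm {N : ℕ} [NeZero N] (d : ZMod N → ℕ) (R : List ℕ → Prop) :
    (Finset.univ.filter fun σ : Equiv.Perm (ZMod N) => R (wordOf (d ∘ σ))).card =
      ((arrangementWords d).filter R).card *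
        (Finset.univ.filter fun σ : Equiv.Perm (ZMod N) => d ∘ σ = d).card := by
  rw [Finset.card_eq_sum_card_fiberwise (f := fun σ : Equiv.Perm (ZMod N) => wordOf (d ∘ σ))
    (t := (arrangementWords d).filter R)]
  · rw [Finset.sum_const_nat (m := (Finset.univ.filter
      fun σ : Equiv.Perm (ZMod N) => d ∘ σ = d).card)]
    intro w hw
    obtain ⟨hw1, hw2⟩ := Finset.mem_filter.mp hw
    obtain ⟨τ, -, rfl⟩ := Finset.mem_image.mp hw1
    refine Finset.card_bij (fun σ _ => τ.symm.trans σ) ?_ ?_ ?_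
    · intro σ hσ
      simp only [Finset.mem_filter, Finset.mem_univ, true_and] at hσ ⊢
      have h := wordOf_injective hσ.2
      ext i
      simpa using congrFun h (τ.symm i)
    · intro σ _ σ' _ h
      ext i
      simpa using Equiv.congr_fun h (τ i)
    · intro σ hσ
      simp only [Finset.mem_filter, Finset.mem_univ, true_and] at hσ ⊢
      have he : d ∘ (τ.trans σ) = d ∘ τ := by
        ext i
        simpa using congrFun hσ (τ i)
      refine ⟨τ.trans σ, by rw [he]; exact ⟨hw2, rfl⟩, ?_⟩
      ext i
      simp
  · intro σ hσ
    simp only [Finset.coe_filter, Set.mem_ofPred_eq, Finset.mem_univ, true_and] at hσ ⊢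
    exact ⟨Finset.mem_image_of_mem _ (Finset.mem_univ _), hσ⟩

/-- The number of fringe subtrees of size `m` in a uniform tree with given degree statistic is
distributed as the number of excursion windows in a uniform cyclic arrangement. -/
theorem prob_countSize_eq {N : ℕ} [NeZero N] (n : ℕ →₀ ℕ) (d : ZMod N → ℕ)
    (hd : Finset.univ.val.map d = Finsupp.toMultiset n)
    (hsum : ∑ i, ((d i : ℤ) - 1) = -1) (m k : ℕ) :
    prob n (fun T => countSize m T = k) =
      ((Finset.univ.filter fun σ : Equiv.Perm (ZMod N) =>
        cyclicCount m ((fun i => (d i : ℤ) - 1) ∘ σ) = k).card : ℝ) /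
        Fintype.card (Equiv.Perm (ZMod N)) := by
  set x : ZMod N → ℤ := fun i => (d i : ℤ) - 1 with hx
  have hK : 0 < (Finset.univ.filter fun σ : Equiv.Perm (ZMod N) => d ∘ σ = d).card :=
    Finset.card_pos.mpr ⟨1, by simp⟩
  obtain ⟨K, hKdef⟩ : ∃ K, K = (Finset.univ.filter fun σ : Equiv.Perm (ZMod N) => d ∘ σ = d).card :=
    ⟨_, rfl⟩
  rw [← hKdef] at hK
  have hgen : ∀ Q : (ZMod N → ℤ) → Prop, (∀ f r, Q (fun i => f (r + i)) ↔ Q f) →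
      ∀ R : List ℕ → Prop, (∀ f : ZMod N → ℕ, ExcWord (wordOf f) →
        (R (wordOf f) ↔ Q fun i => (f i : ℤ) - 1)) →
      N * (({T ∈ treesWith n | R (code T)}).ncard * K) =
        (Finset.univ.filter fun σ : Equiv.Perm (ZMod N) => Q (x ∘ σ)).card := by
    intro Q hQ R hR
    have hcard : ((arrangementWords d).filter fun w => ExcWord w ∧ R w).card * K =
        (Finset.univ.filter fun σ : Equiv.Perm (ZMod N) =>
          ExcWord (wordOf (d ∘ σ)) ∧ R (wordOf (d ∘ σ))).card := by
      rw [hKdef]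
      convert (card_filter_perm d fun w => ExcWord w ∧ R w).symm
    rw [ncard_treesWith n d hd R, hcard, ← card_mul_card_excursion_arrangements x hsum Q hQ]
    congr 2
    ext σ
    simp only [Finset.mem_filter, Finset.mem_univ, true_and]
    have h1 : ExcWord (wordOf (d ∘ σ)) ↔ IsExcursion (fun b => x (σ b)) N :=
      excWord_wordOf (d ∘ σ)
    rw [← h1]
    exact and_congr_right fun h => hR _ h
  have hnum : N * (({T ∈ treesWith n | windowCount m (code T) = k}).ncard * K) =
      (Finset.univ.filter fun σ : Equiv.Perm (ZMod N) => cyclicCount m (x ∘ σ) = k).card := by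
    convert hgen (fun f => cyclicCount m f = k) (fun f r => by rw [cyclicCount_rotate])
      (fun w => windowCount m w = k) (fun f hf => by rw [windowCount_wordOf f m hf])
  have hden := hgen (fun _ => True) (fun _ _ => Iff.rfl) (fun _ => True) (fun _ _ => Iff.rfl)
  have hnum' : ({T ∈ treesWith n | countSize m T = k}).ncard =
      ({T ∈ treesWith n | windowCount m (code T) = k}).ncard := by
    simp only [countSize_eq_windowCount]
  have hden' : numTrees n = ({T ∈ treesWith n | True}).ncard := by
    simp [numTrees]
  rw [prob, hnum', hden', ← hnum]
  rw [Finset.filter_true, Finset.card_univ] at hden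
  rw [← hden]
  have hN : (N : ℝ) ≠ 0 := by exact_mod_cast NeZero.ne N
  have hK' : (K : ℝ) ≠ 0 := by exact_mod_cast hK.ne'
  push_cast
  rw [mul_div_mul_left _ _ hN, mul_div_mul_right _ _ hK']

end PlaneTree

theorem IsExcursion.congr_iff {g g' : ℕ → ℤ} {m : ℕ} (h : ∀ b < m, g b = g' b) :
    IsExcursion g m ↔ IsExcursion g' m := by
  have hs : ∀ j ≤ m, ∑ b ∈ Finset.range j, g b = ∑ b ∈ Finset.range j, g' b := fun j hj =>
    Finset.sum_congr rfl fun b hb => h b ((Finset.mem_range.mp hb).trans_le hj)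
  unfold IsExcursion
  rw [hs m le_rfl]
  exact and_congr_right fun _ => forall₂_congr fun j hj => by rw [hs j hj.le]

theorem descFactorial_card_filter {X : Type*} [Fintype X] (P : X → Prop) (q : ℕ) :
    (Finset.univ.filter P).card.descFactorial q =
      (Finset.univ.filter fun e : Fin q → X => Function.Injective e ∧ ∀ l, P (e l)).card := by
  have h := Fintype.card_embedding_eq (α := Fin q) (β := {x // P x})
  rw [Fintype.card_fin, Fintype.card_subtype] at h
  rw [← h, ← Finset.card_univ]
  refine Finset.card_bij (fun e _ l => (e l : X)) ?_ ?_ ?_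
  · intro e _
    simp only [Finset.mem_filter, Finset.mem_univ, true_and]
    exact ⟨fun a b hab => e.injective (Subtype.ext hab), fun l => (e l).2⟩
  · intro e _ e' _ h
    ext l
    exact congrFun h l
  · intro e he
    simp only [Finset.mem_filter, Finset.mem_univ, true_and] at he
    refine ⟨⟨fun l => ⟨e l, he.2 l⟩, fun a b hab => he.1 (by simpa using hab)⟩,
      Finset.mem_univ _, rfl⟩

theorem exists_perm_extending {P X : Type*} [Finite X] {ι g : P → X} (hι : Function.Injective ι)
    (hg : Function.Injective g) : ∃ τ : Equiv.Perm X, ∀ p, τ (ι p) = g p := by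
  have := Fintype.ofFinite X
  let e : {x // x ∈ Set.range ι} ≃ {x // x ∈ Set.range g} :=
    (Equiv.ofInjective ι hι).symm.trans (Equiv.ofInjective g hg)
  refine ⟨e.extendSubtype, fun p => ?_⟩
  rw [Equiv.extendSubtype_apply_of_mem e (ι p) ⟨p, rfl⟩]
  have : (⟨ι p, ⟨p, rfl⟩⟩ : {x // x ∈ Set.range ι}) = Equiv.ofInjective ι hι p := rfl
  rw [this]
  simp [e]

theorem card_perm_filter_comp_aux {P X : Type*} [Fintype P] [Fintype X] {ι : P → X}
    (hι : Function.Injective ι) (Q : (P → X) → Prop) :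
    (Finset.univ.filter fun σ : Equiv.Perm X => Q (σ ∘ ι)).card =
      (Finset.univ.filter fun g : P → X => Function.Injective g ∧ Q g).card *
        (Finset.univ.filter fun σ : Equiv.Perm X => σ ∘ ι = ι).card := by
  rw [Finset.card_eq_sum_card_fiberwise (f := fun σ : Equiv.Perm X => σ ∘ ι)
    (t := Finset.univ.filter fun g : P → X => Function.Injective g ∧ Q g)]
  · rw [Finset.sum_const_nat (m := (Finset.univ.filter
      fun σ : Equiv.Perm X => σ ∘ ι = ι).card)]
    intro g hg
    simp only [Finset.mem_filter, Finset.mem_univ, true_and] at hg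
    obtain ⟨τ, hτ⟩ := exists_perm_extending hι hg.1
    refine Finset.card_bij (fun σ _ => σ.trans τ.symm) ?_ ?_ ?_
    · intro σ hσ
      simp only [Finset.mem_filter, Finset.mem_univ, true_and] at hσ ⊢
      ext p
      have h := congrFun hσ.2 p
      simp only [Function.comp_apply] at h
      simp [h, ← hτ p]
    · intro σ _ σ' _ h
      ext i
      simpa using Equiv.congr_fun h i
    · intro σ hσ
      simp only [Finset.mem_filter, Finset.mem_univ, true_and] at hσ ⊢
      have he : (σ.trans τ : Equiv.Perm X) ∘ ι = g := by
        ext p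
        have h := congrFun hσ p
        simp only [Function.comp_apply] at h
        simp [h, hτ p]
      refine ⟨σ.trans τ, by rw [he]; exact ⟨hg.2, rfl⟩, ?_⟩
      ext i
      simp
  · intro σ hσ
    simp only [Finset.coe_filter, Set.mem_ofPred_eq, Finset.mem_univ, true_and] at hσ ⊢
    exact ⟨σ.injective.comp hι, hσ⟩

/-- The restriction of a permutation along an injection is a uniform injection. -/
theorem card_perm_filter_comp {P X : Type*} [Fintype P] [Fintype X] {ι : P → X}
    (hι : Function.Injective ι) (Q : (P → X) → Prop) :
    (Finset.univ.filter fun σ : Equiv.Perm X => Q (σ ∘ ι)).card =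
      (Finset.univ.filter fun g : P → X => Function.Injective g ∧ Q g).card *
        (Fintype.card X - Fintype.card P).factorial := by
  rw [card_perm_filter_comp_aux hι Q]
  congr 1
  have hle := Fintype.card_le_of_injective ι hι
  have h1 := card_perm_filter_comp_aux hι fun _ => True
  simp only [and_true, Finset.filter_true, Finset.card_univ, Fintype.card_perm] at h1
  have h2 : (Finset.univ.filter fun g : P → X => Function.Injective g).card =
      (Fintype.card X).descFactorial (Fintype.card P) := by
    rw [← Fintype.card_embedding_eq, ← Fintype.card_subtype]
    exact Fintype.card_congr (Equiv.subtypeInjectiveEquivEmbedding P X)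
  rw [h2, ← Nat.factorial_mul_descFactorial hle, mul_comm] at h1
  exact (Nat.eq_of_mul_eq_mul_left (Nat.descFactorial_pos.mpr hle)
    h1).symm

/-- The number of families of `q` disjoint ordered blocks of size `m` in `J`, each of whose
values sum to `-1`. -/
noncomputable def blockCount {α : Type*} [Fintype α] (x : α → ℤ) (m : ℕ) [NeZero m] (q : ℕ)
    (J : Finset α) : ℕ :=
  (Finset.univ.filter fun g : Fin q → ZMod m → α =>
    (Function.Injective fun p : Fin q × ZMod m => g p.1 p.2) ∧ (∀ l b, g l b ∈ J) ∧
      ∀ l, ∑ b, x (g l b) = -1).card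

/-- The cycle lemma applied simultaneously to `q` disjoint blocks. -/
theorem card_excursion_blocks {α : Type*} [Fintype α] (x : α → ℤ) (m : ℕ) [NeZero m] (q : ℕ) :
    m ^ q * (Finset.univ.filter fun g : Fin q → ZMod m → α =>
      (Function.Injective fun p : Fin q × ZMod m => g p.1 p.2) ∧
        ∀ l, IsExcursion (fun b : ℕ => x (g l b)) m).card = blockCount x m q Finset.univ := by
  have h1 : ∀ r : Fin q → ZMod m, (Finset.univ.filter fun g : Fin q → ZMod m → α =>
      (Function.Injective fun p : Fin q × ZMod m => g p.1 p.2) ∧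
        ∀ l, IsExcursion (fun b : ℕ => x (g l (r l + b))) m).card =
      (Finset.univ.filter fun g : Fin q → ZMod m → α =>
      (Function.Injective fun p : Fin q × ZMod m => g p.1 p.2) ∧
        ∀ l, IsExcursion (fun b : ℕ => x (g l b)) m).card := by
    have hinj : ∀ (r : Fin q → ZMod m) (g : Fin q → ZMod m → α),
        (Function.Injective fun p : Fin q × ZMod m => g p.1 p.2) →
        Function.Injective fun p : Fin q × ZMod m => g p.1 (r p.1 + p.2) := by
      intro r g hg p p' h
      have := @hg (p.1, r p.1 + p.2) (p'.1, r p'.1 + p'.2) h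
      rw [Prod.mk.injEq] at this
      obtain ⟨ha, hb⟩ := this
      rw [ha] at hb
      exact Prod.ext ha (add_left_cancel hb)
    intro r
    refine Finset.card_bij (fun g _ l b => g l (r l + b)) ?_ ?_ ?_
    · intro g hg
      simp only [Finset.mem_filter, Finset.mem_univ, true_and] at hg ⊢
      exact ⟨hinj r g hg.1, hg.2⟩
    · intro g _ g' _ h
      ext l b
      simpa using congrFun (congrFun h l) (-r l + b)
    · intro g hg
      simp only [Finset.mem_filter, Finset.mem_univ, true_and] at hg ⊢
      exact ⟨fun l b => g l (-r l + b), ⟨hinj (fun l => -r l) g hg.1, by simpa using hg.2⟩, by simp⟩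
  have h2 : ∑ r : Fin q → ZMod m, (Finset.univ.filter fun g : Fin q → ZMod m → α =>
      (Function.Injective fun p : Fin q × ZMod m => g p.1 p.2) ∧
        ∀ l, IsExcursion (fun b : ℕ => x (g l (r l + b))) m).card =
      blockCount x m q Finset.univ := by
    unfold blockCount
    simp only [Finset.card_filter]
    rw [Finset.sum_comm]
    refine Finset.sum_congr rfl fun g _ => ?_
    by_cases hg : Function.Injective fun p : Fin q × ZMod m => g p.1 p.2
    swap
    · simp [hg]
    simp only [hg, true_and, Finset.mem_univ, implies_true]
    rw [← Finset.card_filter]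
    by_cases hs : ∀ l, ∑ b, x (g l b) = -1
    · rw [if_pos hs]
      have : (Finset.univ.filter fun r : Fin q → ZMod m =>
          ∀ l, IsExcursion (fun b : ℕ => x (g l (r l + b))) m) =
          Fintype.piFinset fun l => Finset.univ.filter fun r : ZMod m =>
            IsExcursion (fun b : ℕ => x (g l (r + b))) m := by
        ext r
        simp [Fintype.mem_piFinset]
      rw [this, Fintype.card_piFinset]
      exact Finset.prod_eq_one fun l _ => card_rotations_isExcursion (fun b => x (g l b)) (hs l)
    · rw [if_neg hs, Finset.card_eq_zero, Finset.filter_eq_empty_iff]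
      intro r _ hr
      refine hs fun l => ?_
      rw [← (hr l).1, ← Equiv.sum_comp (Equiv.addLeft (r l)), sum_zmod_eq_sum_range]
      rfl
  rw [← h2, Finset.sum_congr rfl fun r _ => h1 r]
  simp [ZMod.card]

/-- The map sending `(l, b)` to the `b`-th position of the `l`-th window of length `m`. -/
def windowPos {N : ℕ} (m : ℕ) {q : ℕ} (e : Fin q → ZMod N) (p : Fin q × ZMod m) : ZMod N :=
  e p.1 + (p.2.val : ZMod N)

theorem natCast_zmod_inj_of_lt {N a b : ℕ} (ha : a < N) (hb : b < N)
    (h : (a : ZMod N) = (b : ZMod N)) : a = b := by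
  have := congrArg ZMod.val h
  rwa [ZMod.val_cast_of_lt ha, ZMod.val_cast_of_lt hb] at this

/-- If windows with distinct starting points are not disjoint, then one starts inside another. -/
theorem exists_of_not_injective_windowPos {N m q : ℕ} [NeZero m] (hmN : m ≤ N)
    (e : Fin q → ZMod N) (h : ¬ Function.Injective (windowPos m e)) :
    ∃ l l' : Fin q, l ≠ l' ∧ ∃ c < m, e l = e l' + (c : ZMod N) := by
  simp only [Function.Injective, not_forall] at h
  obtain ⟨⟨l, b⟩, ⟨l', b'⟩, heq, hne⟩ := h
  simp only [windowPos] at heq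
  have hb := ZMod.val_lt b
  have hb' := ZMod.val_lt b'
  have hl : l ≠ l' := by
    rintro rfl
    refine hne (Prod.ext rfl (ZMod.val_injective m ?_))
    exact natCast_zmod_inj_of_lt (hb.trans_le hmN) (hb'.trans_le hmN) (add_left_cancel heq)
  rcases le_total b.val b'.val with hle | hle
  · refine ⟨l, l', hl, b'.val - b.val, by omega, ?_⟩
    rw [Nat.cast_sub hle]
    linear_combination heq
  · refine ⟨l', l, hl.symm, b.val - b'.val, by omega, ?_⟩
    rw [Nat.cast_sub hle]
    linear_combination -heq

/-- Factorial moments of the number of excursion windows in terms of block counts. -/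
theorem sum_descFactorial_cyclicCount {N m : ℕ} [NeZero N] [NeZero m] (hmN : m ≤ N)
    (x : ZMod N → ℤ) (q : ℕ) :
    m ^ q * ∑ σ : Equiv.Perm (ZMod N), (cyclicCount m (x ∘ σ)).descFactorial q =
      (Finset.univ.filter fun e : Fin q → ZMod N => Function.Injective (windowPos m e)).card *
        (blockCount x m q Finset.univ * (N - q * m).factorial) := by
  have h1 : ∀ σ : Equiv.Perm (ZMod N), (cyclicCount m (x ∘ σ)).descFactorial q =
      ∑ e : Fin q → ZMod N, if Function.Injective e ∧
        ∀ l, IsExcursion (fun b => x (σ (e l + b))) m then 1 else 0 := by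
    intro σ
    rw [cyclicCount, descFactorial_card_filter, Finset.card_filter]
    refine Finset.sum_congr rfl fun e _ => ?_
    simp only [Function.comp_apply]
    congr 1
  simp only [h1]
  rw [Finset.sum_comm, Finset.card_filter, Finset.sum_mul, Finset.mul_sum]
  refine Finset.sum_congr rfl fun e _ => ?_
  rw [← Finset.card_filter]
  by_cases he : Function.Injective (windowPos m e)
  · have heinj : Function.Injective e := by
      intro l l' h
      have := @he (l, 0) (l', 0) (by simp [windowPos, h])
      exact congrArg Prod.fst this
    rw [if_pos he, one_mul, ← card_excursion_blocks]
    have h2 : (Finset.univ.filter fun σ : Equiv.Perm (ZMod N) => Function.Injective e ∧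
        ∀ l, IsExcursion (fun b => x (σ (e l + b))) m) =
        Finset.univ.filter fun σ : Equiv.Perm (ZMod N) => (fun g : Fin q × ZMod m → ZMod N =>
          ∀ l, IsExcursion (fun b : ℕ => x (g (l, b))) m) (σ ∘ windowPos m e) := by
      ext σ
      simp only [heinj, true_and, Finset.mem_filter, Finset.mem_univ]
      refine forall_congr' fun l => IsExcursion.congr_iff fun b hb => ?_
      simp [windowPos, ZMod.val_cast_of_lt hb]
    have h3 : (Finset.univ.filter fun σ : Equiv.Perm (ZMod N) =>
        (fun g : Fin q × ZMod m → ZMod N => ∀ l, IsExcursion (fun b : ℕ => x (g (l, b))) m)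
          (σ ∘ windowPos m e)).card =
        (Finset.univ.filter fun g : Fin q × ZMod m → ZMod N => Function.Injective g ∧
          ∀ l, IsExcursion (fun b : ℕ => x (g (l, b))) m).card *
          (Fintype.card (ZMod N) - Fintype.card (Fin q × ZMod m)).factorial := by
      convert card_perm_filter_comp he fun g => ∀ l, IsExcursion (fun b : ℕ => x (g (l, b))) m
    rw [h2, h3]
    rw [Fintype.card_prod, ZMod.card, ZMod.card, Fintype.card_fin, mul_assoc]
    congr 2
    refine Finset.card_bij (fun g _ l b => g (l, b)) ?_ ?_ ?_
    · intro g hg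
      simpa using hg
    · intro g _ g' _ h
      ext p
      exact congrFun (congrFun h p.1) p.2
    · intro g hg
      exact ⟨fun p => g p.1 p.2, by simpa using hg, rfl⟩
  · rw [if_neg he, zero_mul]
    refine Nat.mul_eq_zero.mpr (Or.inr ?_)
    rw [Finset.card_eq_zero, Finset.filter_eq_empty_iff]
    rintro σ - ⟨heinj, hexc⟩
    obtain ⟨l, l', hl, c, hc, hel⟩ := exists_of_not_injective_windowPos hmN e he
    have hc0 : 0 < c := by
      rcases Nat.eq_zero_or_pos c with rfl | h
      · exact absurd (heinj (by simpa using hel)) hl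
      · exact h
    refine (hexc l').not_overlap hc0 hc ?_
    have := hexc l
    rw [hel] at this
    simpa [add_assoc] using this

/-- Almost all tuples of windows are disjoint. -/
theorem card_not_injective_windowPos_le {N m : ℕ} [NeZero N] [NeZero m] (hmN : m ≤ N) (q : ℕ) :
    N * (Finset.univ.filter fun e : Fin q → ZMod N =>
      ¬ Function.Injective (windowPos m e)).card ≤ q * q * m * N ^ q := by
  have hsub : (Finset.univ.filter fun e : Fin q → ZMod N => ¬ Function.Injective (windowPos m e)) ⊆
      (((Finset.univ : Finset (Fin q × Fin q)) ×ˢ Finset.range m).filter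
        fun t => t.1.1 ≠ t.1.2).biUnion fun t =>
        Finset.univ.filter fun e : Fin q → ZMod N => e t.1.1 = e t.1.2 + (t.2 : ZMod N) := by
    intro e he
    obtain ⟨l, l', hl, c, hc, hel⟩ := exists_of_not_injective_windowPos hmN e (by simpa using he)
    simp only [Finset.mem_biUnion, Finset.mem_filter, Finset.mem_product, Finset.mem_univ,
      true_and, Finset.mem_range]
    exact ⟨((l, l'), c), ⟨hc, hl⟩, hel⟩
  have hone : ∀ l l' : Fin q, l ≠ l' → ∀ c : ZMod N,
      N * (Finset.univ.filter fun e : Fin q → ZMod N => e l = e l' + c).card ≤ N ^ q := by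
    intro l l' hl c
    have hq : 0 < q := l.pos
    have : (Finset.univ.filter fun e : Fin q → ZMod N => e l = e l' + c).card ≤
        (Finset.univ : Finset ({j : Fin q // j ≠ l} → ZMod N)).card := by
      refine Finset.card_le_card_of_injOn (fun e j => e j) (fun _ _ => Finset.mem_univ _) ?_
      intro e he e' he' h
      simp only [Finset.coe_filter, Finset.mem_univ, true_and, Set.mem_ofPred_eq] at he he'
      have hj : ∀ j, j ≠ l → e j = e' j := fun j hj => congrFun h ⟨j, hj⟩
      ext j
      by_cases h' : j = l
      · subst h'
        rw [he, he', hj l' hl.symm]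
      · exact hj j h'
    rw [Finset.card_univ, Fintype.card_fun, ZMod.card, Fintype.card_subtype_compl,
      Fintype.card_fin, Fintype.card_subtype_eq] at this
    calc _ ≤ N * N ^ (q - 1) := Nat.mul_le_mul_left _ this
      _ = N ^ q := by rw [← pow_succ', Nat.sub_add_cancel hq]
  calc _ ≤ N * ∑ t ∈ ((Finset.univ : Finset (Fin q × Fin q)) ×ˢ Finset.range m).filter
        fun t => t.1.1 ≠ t.1.2,
        (Finset.univ.filter fun e : Fin q → ZMod N => e t.1.1 = e t.1.2 + (t.2 : ZMod N)).card :=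
        Nat.mul_le_mul_left _ ((Finset.card_le_card hsub).trans Finset.card_biUnion_le)
    _ ≤ ∑ _t ∈ ((Finset.univ : Finset (Fin q × Fin q)) ×ˢ Finset.range m).filter
        fun t => t.1.1 ≠ t.1.2, N ^ q := by
        rw [Finset.mul_sum]
        exact Finset.sum_le_sum fun t ht => hone _ _ (Finset.mem_filter.mp ht).2 _
    _ ≤ ∑ _t ∈ (Finset.univ : Finset (Fin q × Fin q)) ×ˢ Finset.range m, N ^ q :=
        Finset.sum_le_sum_of_subset (Finset.filter_subset _ _)
    _ = q * q * m * N ^ q := by simp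

/-- Choosing the first block, then the others from the remaining items. -/
theorem blockCount_succ {α : Type*} [Fintype α] (x : α → ℤ) (m : ℕ) [NeZero m] (q : ℕ)
    (J : Finset α) :
    blockCount x m (q + 1) J = ∑ h ∈ Finset.univ.filter fun h : ZMod m → α =>
      Function.Injective h ∧ (∀ b, h b ∈ J) ∧ ∑ b, x (h b) = -1,
      blockCount x m q (J \ Finset.univ.image h) := by
  unfold blockCount
  rw [← Finset.card_sigma]
  refine (Finset.card_bij (fun s _ => Fin.cons s.1 s.2) ?_ ?_ ?_).symm
  · rintro ⟨h, g⟩ hs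
    simp only [Finset.mem_sigma, Finset.mem_filter, Finset.mem_univ, true_and, Finset.mem_sdiff,
      Finset.mem_image, not_exists] at hs
    obtain ⟨⟨h1, h2, h3⟩, g1, g2, g3⟩ := hs
    simp only [Finset.mem_filter, Finset.mem_univ, true_and]
    refine ⟨?_, ?_, ?_⟩
    · rintro ⟨l, b⟩ ⟨l', b'⟩ hll
      induction l using Fin.cases with
      | zero =>
        induction l' using Fin.cases with
        | zero => simpa using h1 (by simpa using hll)
        | succ l' => exact absurd (by simpa using hll) ((g2 l' b').2 b)
      | succ l =>
        induction l' using Fin.cases with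
        | zero => exact absurd (by simpa using hll.symm) ((g2 l b).2 b')
        | succ l' =>
          have := @g1 (l, b) (l', b') (by simpa using hll)
          simpa using this
    · intro l b
      induction l using Fin.cases with
      | zero => simpa using h2 b
      | succ l => simpa using (g2 l b).1
    · intro l
      induction l using Fin.cases with
      | zero => simpa using h3
      | succ l => simpa using g3 l
  · rintro ⟨h, g⟩ _ ⟨h', g'⟩ _ heq
    obtain ⟨rfl, rfl⟩ := Fin.cons_injective2 heq
    rfl
  · intro g hg
    simp only [Finset.mem_filter, Finset.mem_univ, true_and] at hg
    obtain ⟨g1, g2, g3⟩ := hg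
    refine ⟨⟨g 0, fun l => g l.succ⟩, ?_, Fin.cons_self_tail g⟩
    simp only [Finset.mem_sigma, Finset.mem_filter, Finset.mem_univ, true_and, Finset.mem_sdiff,
      Finset.mem_image, not_exists]
    refine ⟨⟨?_, g2 0, g3 0⟩, ?_, ?_, fun l => g3 _⟩
    · intro b b' h
      have := @g1 (0, b) (0, b') h
      simpa using this
    · intro p p' h
      have := @g1 (p.1.succ, p.2) (p'.1.succ, p'.2) h
      simpa [Prod.ext_iff] using this
    · intro l b
      refine ⟨g2 _ _, fun b' h => ?_⟩
      have := @g1 (0, b') (l.succ, b) h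
      simp [Fin.ext_iff] at this

theorem blockCount_zero {α : Type*} [Fintype α] (x : α → ℤ) (m : ℕ) [NeZero m]
    (J : Finset α) : blockCount x m 0 J = 1 := by
  have : (Function.Injective fun p : Fin 0 × ZMod m => (p.1.elim0 : α)) :=
    fun p => p.1.elim0
  unfold blockCount
  rw [Finset.filter_true_of_mem]
  · simp
  · exact fun g _ => ⟨fun p => p.1.elim0, fun l => l.elim0, fun l => l.elim0⟩

/-- Ordered blocks versus subsets. -/
theorem card_ordered_blocks {α : Type*} [Fintype α] (x : α → ℤ) (m : ℕ) [NeZero m]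
    (J : Finset α) :
    (Finset.univ.filter fun h : ZMod m → α =>
      Function.Injective h ∧ (∀ b, h b ∈ J) ∧ ∑ b, x (h b) = -1).card =
      ((J.powersetCard m).filter fun A => ∑ a ∈ A, x a = -1).card * m.factorial := by
  rw [Finset.card_eq_sum_card_fiberwise (f := fun h : ZMod m → α => Finset.univ.image h)
    (t := (J.powersetCard m).filter fun A => ∑ a ∈ A, x a = -1)]
  · rw [Finset.sum_const_nat]
    intro A hA
    simp only [Finset.mem_filter, Finset.mem_powersetCard] at hA
    have hcard : Fintype.card (ZMod m) = Fintype.card A := by simp [hA.1.2, ZMod.card]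
    have h1 := Fintype.card_equiv (Fintype.equivOfCardEq hcard)
    rw [ZMod.card] at h1
    rw [← h1, ← Finset.card_univ]
    refine (Finset.card_bij (fun (e : ZMod m ≃ A) _ b => (e b : α)) ?_ ?_ ?_).symm
    · intro e _
      have hinj : Function.Injective fun b => (e b : α) :=
        Subtype.val_injective.comp e.injective
      have himg : Finset.univ.image (fun b => (e b : α)) = A := by
        ext a
        simp only [Finset.mem_image, Finset.mem_univ, true_and]
        exact ⟨by rintro ⟨b, rfl⟩; exact (e b).2, fun ha => ⟨e.symm ⟨a, ha⟩, by simp⟩⟩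
      simp only [Finset.mem_filter, Finset.mem_univ, true_and]
      refine ⟨⟨hinj, fun b => hA.1.1 (e b).2, ?_⟩, himg⟩
      rw [← hA.2]
      exact (Equiv.sum_comp e fun a : A => x a).trans (Finset.sum_coe_sort A x)
    · intro e _ e' _ h
      ext b
      exact congrFun h b
    · intro h hh
      simp only [Finset.mem_filter, Finset.mem_univ, true_and] at hh
      obtain ⟨⟨hinj, -, -⟩, himg⟩ := hh
      have hmem : ∀ b, h b ∈ A := fun b => by rw [← himg]; simp
      refine ⟨Equiv.ofBijective (fun b => ⟨h b, hmem b⟩) ?_, Finset.mem_univ _, rfl⟩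
      rw [Fintype.bijective_iff_injective_and_card]
      exact ⟨fun b b' hb => hinj (by simpa using hb), hcard⟩
  · intro h hh
    simp only [Finset.coe_filter, Set.mem_ofPred_eq, Finset.mem_univ, true_and,
      Finset.mem_powersetCard] at hh ⊢
    obtain ⟨h1, h2, h3⟩ := hh
    refine ⟨⟨?_, by rw [Finset.card_image_of_injective _ h1]; simp [ZMod.card]⟩, ?_⟩
    · intro a ha
      obtain ⟨b, -, rfl⟩ := Finset.mem_image.mp ha
      exact h2 b
    · rw [Finset.sum_image fun a _ b _ h => h1 h]
      exact h3

theorem setIntegral_exp_int_mul (k : ℤ) :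
    ∫ u in Set.Icc (-Real.pi) Real.pi, Complex.exp (Complex.I * k * u) =
      if k = 0 then 2 * Real.pi else 0 := by
  rw [integral_Icc_eq_integral_Ioc, ← intervalIntegral.integral_of_le (by linarith [Real.pi_pos])]
  split_ifs with h
  · subst h
    simp [two_mul]
  · have hc : Complex.I * k ≠ 0 := mul_ne_zero Complex.I_ne_zero (by exact_mod_cast h)
    rw [integral_exp_mul_complex hc, Complex.ofReal_zero, div_eq_zero_iff, sub_eq_zero]
    left
    rw [Complex.exp_eq_exp_iff_exists_int]
    exact ⟨k, by push_cast; ring⟩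

/-- The characteristic function of a Bernoulli random variable. -/
noncomputable def bernoulliChar (r α : ℝ) : ℂ := (1 - r) + r * Complex.exp (Complex.I * α)

theorem continuous_bernoulliChar (r : ℝ) : Continuous (bernoulliChar r) := by
  unfold bernoulliChar
  fun_prop

/-- Two-dimensional Fourier inversion for the number of subsets with a given size and sum. -/
theorem fourier_card_subsets {α : Type*} (x : α → ℤ) (J : Finset α) (m : ℕ) (r : ℝ) :
    ∫ z in Set.Icc (-Real.pi) Real.pi ×ˢ Set.Icc (-Real.pi) Real.pi,
      Complex.exp (Complex.I * (z.2 - m * z.1)) * ∏ j ∈ J, bernoulliChar r (z.1 + z.2 * x j) =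
    ((4 * Real.pi ^ 2 * (r ^ m * (1 - r) ^ (J.card - m) *
      ((J.powersetCard m).filter fun A => ∑ a ∈ A, x a = -1).card) : ℝ) : ℂ) := by
  have h1 : ∀ z : ℝ × ℝ, Complex.exp (Complex.I * (z.2 - m * z.1)) *
      ∏ j ∈ J, bernoulliChar r (z.1 + z.2 * x j) =
      ∑ A ∈ J.powerset, ((r : ℂ) ^ A.card * (1 - r) ^ (J.card - A.card)) *
        (Complex.exp (Complex.I * ((A.card - m : ℤ) : ℂ) * z.1) *
          Complex.exp (Complex.I * ((∑ a ∈ A, x a + 1 : ℤ) : ℂ) * z.2)) := by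
    intro z
    simp only [bernoulliChar]
    rw [Finset.prod_congr rfl fun j _ => add_comm _ _, Finset.prod_add, Finset.mul_sum]
    refine Finset.sum_congr rfl fun A hA => ?_
    rw [Finset.prod_const, Finset.card_sdiff_of_subset (Finset.mem_powerset.mp hA),
      Finset.prod_mul_distrib, Finset.prod_const, ← Complex.exp_sum, ← Complex.exp_add]
    have : Complex.exp (Complex.I * ((A.card - m : ℤ) : ℂ) * z.1 +
        Complex.I * ((∑ a ∈ A, x a + 1 : ℤ) : ℂ) * z.2) =
        Complex.exp (Complex.I * (z.2 - m * z.1)) *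
          Complex.exp (∑ a ∈ A, Complex.I * ((z.1 + z.2 * x a : ℝ) : ℂ)) := by
      rw [← Complex.exp_add, ← Finset.mul_sum]
      congr 1
      push_cast
      rw [Finset.sum_add_distrib, Finset.sum_const, ← Finset.mul_sum, nsmul_eq_mul]
      ring
    rw [this]
    ring
  have hint : ∀ A ∈ J.powerset, IntegrableOn (fun z : ℝ × ℝ =>
      ((r : ℂ) ^ A.card * (1 - r) ^ (J.card - A.card)) *
        (Complex.exp (Complex.I * ((A.card - m : ℤ) : ℂ) * z.1) *
          Complex.exp (Complex.I * ((∑ a ∈ A, x a + 1 : ℤ) : ℂ) * z.2)))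
      (Set.Icc (-Real.pi) Real.pi ×ˢ Set.Icc (-Real.pi) Real.pi) := by
    intro A _
    refine ContinuousOn.integrableOn_compact (isCompact_Icc.prod isCompact_Icc) ?_
    fun_prop
  simp only [h1]
  rw [integral_finsetSum _ hint]
  simp only [integral_const_mul]
  have h2 : ∀ k l : ℤ, ∫ z in Set.Icc (-Real.pi) Real.pi ×ˢ Set.Icc (-Real.pi) Real.pi,
      Complex.exp (Complex.I * k * (z : ℝ × ℝ).1) * Complex.exp (Complex.I * l * z.2) =
      (if k = 0 then 2 * Real.pi else 0) * (if l = 0 then 2 * Real.pi else 0) := by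
    intro k l
    have := setIntegral_prod_mul (μ := (volume : Measure ℝ)) (ν := (volume : Measure ℝ))
      (fun u : ℝ => Complex.exp (Complex.I * k * u)) (fun u : ℝ => Complex.exp (Complex.I * l * u))
      (Set.Icc (-Real.pi) Real.pi) (Set.Icc (-Real.pi) Real.pi)
    rw [setIntegral_exp_int_mul, setIntegral_exp_int_mul, ← Measure.volume_eq_prod] at this
    exact this
  simp only [h2]
  rw [Finset.card_filter, Finset.powersetCard_eq_filter, Finset.sum_filter]
  push_cast
  rw [Finset.mul_sum, Finset.mul_sum]
  refine Finset.sum_congr rfl fun A _ => ?_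
  have e1 : ((A.card : ℤ) - m = 0) ↔ A.card = m := by omega
  have e2 : (∑ a ∈ A, x a + 1 = 0) ↔ ∑ a ∈ A, x a = -1 := by omega
  simp only [e1, e2]
  split_ifs with h h'
  · rw [h]; push_cast; ring
  · simp
  · simp
  · simp

theorem norm_bernoulliChar_le (r α : ℝ) :
    ‖bernoulliChar r α‖ ≤ Real.exp (-(r * (1 - r) * (1 - Real.cos α))) := by
  have hsq : ‖bernoulliChar r α‖ ^ 2 = 1 - 2 * (r * (1 - r) * (1 - Real.cos α)) := by
    have : bernoulliChar r α = ((1 - r + r * Real.cos α : ℝ) : ℂ) +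
        ((r * Real.sin α : ℝ) : ℂ) * Complex.I := by
      rw [bernoulliChar, mul_comm Complex.I, Complex.exp_mul_I]
      push_cast
      ring
    rw [this, ← Complex.normSq_eq_norm_sq, Complex.normSq_add_mul_I]
    linear_combination r ^ 2 * Real.sin_sq_add_cos_sq α
  refine abs_le_of_sq_le_sq' ?_ (Real.exp_pos _).le |>.2
  rw [hsq, ← Real.exp_nat_mul]
  have := Real.add_one_le_exp (-(2 * (r * (1 - r) * (1 - Real.cos α))))
  push_cast
  rw [mul_neg]
  linarith

theorem norm_prod_sub_prod_le {ι : Type*} (s : Finset ι) (f g : ι → ℂ)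
    (hf : ∀ i ∈ s, ‖f i‖ ≤ 1) (hg : ∀ i ∈ s, ‖g i‖ ≤ 1) :
    ‖∏ i ∈ s, f i - ∏ i ∈ s, g i‖ ≤ ∑ i ∈ s, ‖f i - g i‖ := by
  induction s using Finset.induction_on with
  | empty => simp
  | insert i s hi ih =>
    rw [Finset.prod_insert hi, Finset.prod_insert hi, Finset.sum_insert hi]
    have hgs : ‖∏ i ∈ s, g i‖ ≤ 1 := by
      rw [norm_prod]
      exact Finset.prod_le_one (fun _ _ => norm_nonneg _)
        fun j hj => hg j (Finset.mem_insert_of_mem hj)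
    have ih' := ih (fun j hj => hf j (Finset.mem_insert_of_mem hj))
      fun j hj => hg j (Finset.mem_insert_of_mem hj)
    have hfi := hf i (Finset.mem_insert_self _ _)
    calc _ = ‖f i * (∏ i ∈ s, f i - ∏ i ∈ s, g i) + (f i - g i) * ∏ i ∈ s, g i‖ := by
          congr 1; ring
      _ ≤ ‖f i‖ * ‖∏ i ∈ s, f i - ∏ i ∈ s, g i‖ + ‖f i - g i‖ * ‖∏ i ∈ s, g i‖ := by
          rw [← norm_mul, ← norm_mul]; exact norm_add_le _ _
      _ ≤ 1 * ∑ i ∈ s, ‖f i - g i‖ + ‖f i - g i‖ * 1 := by gcongr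
      _ = _ := by ring

/-- Second-order Taylor bound for the complex exponential on the imaginary axis. -/
theorem norm_exp_I_mul_sub_taylor_le (α : ℝ) :
    ‖Complex.exp (Complex.I * α) - 1 - Complex.I * α + α ^ 2 / 2‖ ≤ 4 * min (|α| ^ 3) (α ^ 2) := by
  have heq : Complex.exp (Complex.I * α) - 1 - Complex.I * α + α ^ 2 / 2 =
      Complex.exp (Complex.I * α) - ∑ k ∈ Finset.range 3, (Complex.I * α) ^ k / k.factorial := by
    simp [Finset.sum_range_succ, mul_pow]
    ring
  have hn : ‖Complex.I * (α : ℂ)‖ = |α| := by simp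
  rcases le_total |α| 1 with h | h
  · have hb := Complex.norm_exp_sub_sum_le_norm_mul_exp (Complex.I * α) 3
    rw [hn] at hb
    have he : Real.exp |α| ≤ 4 :=
      (Real.exp_le_exp.mpr h).trans (Real.exp_one_lt_d9.le.trans (by norm_num))
    have hmin : |α| ^ 3 ≤ α ^ 2 := by
      rw [← sq_abs, pow_succ]
      exact mul_le_of_le_one_right (by positivity) h
    rw [min_eq_left hmin, heq]
    calc _ ≤ _ := hb
      _ ≤ |α| ^ 3 * 4 := by gcongr
      _ = _ := by ring
  · have hmin : α ^ 2 ≤ |α| ^ 3 := by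
      rw [← sq_abs, pow_succ _ 2]
      exact le_mul_of_one_le_right (by positivity) h
    rw [min_eq_right hmin]
    have h1 := Real.norm_exp_I_mul_ofReal_sub_one_le (x := α)
    calc _ ≤ ‖Complex.exp (Complex.I * α) - 1‖ + ‖Complex.I * (α : ℂ)‖ + ‖((α ^ 2 / 2 : ℝ) : ℂ)‖ := by
          push_cast
          exact (norm_add_le _ _).trans (by gcongr; exact norm_sub_le _ _)
      _ ≤ |α| + |α| + α ^ 2 / 2 := by
          rw [hn, Complex.norm_real, Real.norm_eq_abs, abs_of_nonneg (by positivity : 0 ≤ α ^ 2 / 2)]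
          gcongr
          exact h1
      _ ≤ 4 * α ^ 2 := by
          rw [← sq_abs]; nlinarith

/-- Regularity of a sequence of finite populations `J κ` with integer values `x κ`, from which
samples of size `m κ` are drawn. -/
structure RegularPopulation {α : ℕ → Type*} (x : ∀ κ, α κ → ℤ) (m : ℕ → ℕ) (v : ℝ)
    (F : Finset ℤ) (J : ∀ κ, Finset (α κ)) : Prop where
  tendsto_sample : Tendsto m atTop atTop
  tendsto_card : Tendsto (fun κ => (J κ).card) atTop atTop
  tendsto_ratio : Tendsto (fun κ => (m κ : ℝ) / (J κ).card) atTop (𝓝 0)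
  sum_bounded : ∃ B : ℝ, ∀ᶠ κ in atTop, |∑ j ∈ J κ, (x κ j : ℝ)| ≤ B
  tendsto_sum_sq : Tendsto (fun κ => (∑ j ∈ J κ, (x κ j : ℝ) ^ 2) / (J κ).card) atTop (𝓝 v)
  tail : ∀ ε > 0, ∃ K : ℝ, ∀ᶠ κ in atTop,
    ∑ j ∈ (J κ).filter (fun j => K < |(x κ j : ℝ)|), (x κ j : ℝ) ^ 2 ≤ ε * (J κ).card
  frequent : ∃ c > (0 : ℝ), ∀ᶠ κ in atTop, ∀ i ∈ F,
    c * (J κ).card ≤ ((J κ).filter fun j => x κ j = i).card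

theorem norm_prod_bernoulliChar_sub_exp_le {ι : Type*} (J : Finset ι) (α : ι → ℝ) {r : ℝ}
    (h0 : 0 ≤ r) (h1 : r ≤ 1 / 2) :
    ‖∏ j ∈ J, bernoulliChar r (α j) -
      Complex.exp (∑ j ∈ J, r * (Complex.exp (Complex.I * α j) - 1))‖ ≤
      r * ∑ j ∈ J, r * α j ^ 2 := by
  rw [Complex.exp_sum]
  have hcos : ∀ a : ℝ, 0 ≤ 1 - Real.cos a := fun a => by linarith [Real.cos_le_one a]
  refine (norm_prod_sub_prod_le _ _ _ ?_ ?_).trans ?_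
  · intro j _
    refine (norm_bernoulliChar_le r _).trans (Real.exp_le_one_iff.mpr ?_)
    have : 0 ≤ r * (1 - r) * (1 - Real.cos (α j)) :=
      mul_nonneg (mul_nonneg h0 (by linarith)) (hcos _)
    linarith
  · intro j _
    rw [Complex.norm_exp]
    refine Real.exp_le_one_iff.mpr ?_
    have : ((r : ℂ) * (Complex.exp (Complex.I * α j) - 1)).re = -(r * (1 - Real.cos (α j))) := by
      rw [Complex.re_ofReal_mul, Complex.sub_re, mul_comm Complex.I, Complex.exp_ofReal_mul_I_re,
        Complex.one_re]
      ring
    rw [this]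
    linarith [mul_nonneg h0 (hcos (α j))]
  · rw [Finset.mul_sum]
    refine Finset.sum_le_sum fun j _ => ?_
    have hy := Real.norm_exp_I_mul_ofReal_sub_one_le (x := α j)
    have hn : ‖(r : ℂ) * (Complex.exp (Complex.I * α j) - 1)‖ =
        r * ‖Complex.exp (Complex.I * α j) - 1‖ := by
      rw [norm_mul, Complex.norm_real, Real.norm_of_nonneg h0]
    have hy2 : ‖Complex.exp (Complex.I * α j) - 1‖ ≤ 2 := by
      refine (norm_sub_le _ _).trans ?_
      rw [mul_comm, Complex.norm_exp_ofReal_mul_I]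
      norm_num
    have := Complex.norm_exp_sub_one_sub_id_le
      (x := (r : ℂ) * (Complex.exp (Complex.I * α j) - 1)) (by rw [hn]; nlinarith)
    rw [norm_sub_rev]
    calc _ = ‖Complex.exp (r * (Complex.exp (Complex.I * α j) - 1)) - 1 -
          r * (Complex.exp (Complex.I * α j) - 1)‖ := by
          congr 1; unfold bernoulliChar; ring
      _ ≤ _ := this
      _ = r * (r * ‖Complex.exp (Complex.I * α j) - 1‖ ^ 2) := by rw [hn]; ring
      _ ≤ r * (r * α j ^ 2) := by
          rw [← sq_abs (α j)]
          gcongr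
          exact hy

theorem sum_min_cube_sq_le {ι : Type*} (J : Finset ι) (x : ι → ℝ) (v w : ℝ) {s r K : ℝ}
    (hs : 0 < s) (hr : 0 ≤ r) (hK : 1 ≤ K) :
    ∑ j ∈ J, r * min (|v / s + w / s * x j| ^ 3) ((v / s + w / s * x j) ^ 2) ≤
      (|v| + |w| * K) / s * ∑ j ∈ J, r * (v / s + w / s * x j) ^ 2 +
        r / s ^ 2 * (|v| + |w|) ^ 2 * ∑ j ∈ J.filter (fun j => K < |x j|), x j ^ 2 := by
  rw [Finset.mul_sum, Finset.mul_sum, Finset.sum_filter, ← Finset.sum_add_distrib]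
  refine Finset.sum_le_sum fun j _ => ?_
  have hα : |v / s + w / s * x j| ≤ (|v| + |w| * |x j|) / s := by
    refine (abs_add_le _ _).trans (le_of_eq ?_)
    rw [abs_mul, abs_div, abs_div, abs_of_pos hs]
    ring
  split_ifs with h
  · have h1 : (v / s + w / s * x j) ^ 2 ≤ (1 / s ^ 2) * (|v| + |w|) ^ 2 * x j ^ 2 := by
      have h2 : (|v| + |w| * |x j|) / s ≤ (|v| + |w|) * |x j| / s := by
        gcongr
        nlinarith [abs_nonneg v]
      calc _ = |v / s + w / s * x j| ^ 2 := (sq_abs _).symm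
        _ ≤ ((|v| + |w|) * |x j| / s) ^ 2 := by gcongr; exact hα.trans h2
        _ = (1 / s ^ 2) * (|v| + |w|) ^ 2 * |x j| ^ 2 := by ring
        _ = _ := by rw [sq_abs]
    have h3 : 0 ≤ (|v| + |w| * K) / s * (r * (v / s + w / s * x j) ^ 2) := by positivity
    calc _ ≤ r * (v / s + w / s * x j) ^ 2 := by gcongr; exact min_le_right _ _
      _ ≤ r * ((1 / s ^ 2) * (|v| + |w|) ^ 2 * x j ^ 2) := by gcongr
      _ = r / s ^ 2 * (|v| + |w|) ^ 2 * x j ^ 2 := by ring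
      _ ≤ _ := le_add_of_nonneg_left h3
  · rw [add_zero]
    calc _ ≤ r * |v / s + w / s * x j| ^ 3 := by gcongr; exact min_le_left _ _
      _ = |v / s + w / s * x j| * (r * (v / s + w / s * x j) ^ 2) := by rw [← sq_abs]; ring
      _ ≤ _ := by
        gcongr
        refine hα.trans ?_
        gcongr
        exact not_lt.mp h

namespace RegularPopulation

variable {α : ℕ → Type*} {x : ∀ κ, α κ → ℤ} {m : ℕ → ℕ} {v : ℝ} {F : Finset ℤ}
  {J : ∀ κ, Finset (α κ)}

theorem eventually_pos (h : RegularPopulation x m v F J) :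
    ∀ᶠ κ in atTop, 0 < (m κ : ℝ) ∧ 0 < ((J κ).card : ℝ) ∧ (m κ : ℝ) / (J κ).card ≤ 1 / 2 := by
  filter_upwards [h.tendsto_sample.eventually_gt_atTop 0, h.tendsto_card.eventually_gt_atTop 0,
    h.tendsto_ratio.eventually_le_const (by norm_num : (0 : ℝ) < 1 / 2)] with κ h1 h2 h3
  exact ⟨by exact_mod_cast h1, by exact_mod_cast h2, h3⟩

theorem tendsto_sqrt_sample (h : RegularPopulation x m v F J) :
    Tendsto (fun κ => √(m κ : ℝ)) atTop atTop :=
  Real.tendsto_sqrt_atTop.comp (tendsto_natCast_atTop_atTop.comp h.tendsto_sample)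

theorem tendsto_sum_div_card (h : RegularPopulation x m v F J) :
    Tendsto (fun κ => (∑ j ∈ J κ, (x κ j : ℝ)) / (J κ).card) atTop (𝓝 0) := by
  obtain ⟨B, hB⟩ := h.sum_bounded
  have hc : Tendsto (fun κ => B / ((J κ).card : ℝ)) atTop (𝓝 0) :=
    tendsto_const_nhds.div_atTop (tendsto_natCast_atTop_atTop.comp h.tendsto_card)
  refine squeeze_zero_norm' ?_ hc
  filter_upwards [hB] with κ hκ
  rw [norm_div, Real.norm_natCast]
  gcongr
  exact hκ

theorem tendsto_sum_angle_sq (h : RegularPopulation x m v F J) (a b : ℝ) :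
    Tendsto (fun κ => ∑ j ∈ J κ, (m κ : ℝ) / (J κ).card *
      (a / √(m κ : ℝ) + b / √(m κ : ℝ) * x κ j) ^ 2) atTop (𝓝 (a ^ 2 + v * b ^ 2)) := by
  have h1 : Tendsto (fun κ => a ^ 2 + 2 * a * b * ((∑ j ∈ J κ, (x κ j : ℝ)) / (J κ).card) +
      b ^ 2 * ((∑ j ∈ J κ, (x κ j : ℝ) ^ 2) / (J κ).card)) atTop
      (𝓝 (a ^ 2 + 2 * a * b * 0 + b ^ 2 * v)) :=
    (tendsto_const_nhds.add (h.tendsto_sum_div_card.const_mul _)).add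
      (h.tendsto_sum_sq.const_mul _)
  rw [show a ^ 2 + v * b ^ 2 = a ^ 2 + 2 * a * b * 0 + b ^ 2 * v by ring]
  refine h1.congr' ?_
  filter_upwards [h.eventually_pos] with κ hκ
  obtain ⟨hm, hN, -⟩ := hκ
  have hs : √(m κ : ℝ) ^ 2 = m κ := Real.sq_sqrt hm.le
  have : ∀ j ∈ J κ, (m κ : ℝ) / (J κ).card * (a / √(m κ : ℝ) + b / √(m κ : ℝ) * x κ j) ^ 2 =
      (1 / ((J κ).card : ℝ)) * (a ^ 2 + 2 * a * b * x κ j + b ^ 2 * (x κ j : ℝ) ^ 2) := by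
    intro j _
    rw [show a / √(m κ : ℝ) + b / √(m κ : ℝ) * x κ j = (a + b * x κ j) / √(m κ : ℝ) by ring,
      div_pow, hs]
    field_simp
    ring
  rw [Finset.sum_congr rfl this, ← Finset.mul_sum, Finset.sum_add_distrib,
    Finset.sum_add_distrib, Finset.sum_const, ← Finset.mul_sum, ← Finset.mul_sum, nsmul_eq_mul]
  field_simp

theorem tendsto_sum_remainder (h : RegularPopulation x m v F J) (a b : ℝ) :
    Tendsto (fun κ => ∑ j ∈ J κ, (m κ : ℝ) / (J κ).card *
      min (|a / √(m κ : ℝ) + b / √(m κ : ℝ) * x κ j| ^ 3)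
        ((a / √(m κ : ℝ) + b / √(m κ : ℝ) * x κ j) ^ 2)) atTop (𝓝 0) := by
  refine tendsto_order.mpr ⟨fun y hy => Eventually.of_forall fun κ => hy.trans_le ?_, ?_⟩
  · exact Finset.sum_nonneg fun j _ => by positivity
  intro ε hε
  set M := (|a| + |b|) ^ 2 with hM
  have hM0 : 0 ≤ M := by positivity
  obtain ⟨K, hK⟩ := h.tail (ε / (2 * (M + 1))) (by positivity)
  have hlim : Tendsto (fun κ => (|a| + |b| * max K 1) / √(m κ : ℝ) * ∑ j ∈ J κ,
      (m κ : ℝ) / (J κ).card * (a / √(m κ : ℝ) + b / √(m κ : ℝ) * x κ j) ^ 2) atTop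
      (𝓝 (0 * (a ^ 2 + v * b ^ 2))) :=
    (tendsto_const_nhds.div_atTop h.tendsto_sqrt_sample).mul (h.tendsto_sum_angle_sq a b)
  rw [zero_mul] at hlim
  filter_upwards [hK, hlim.eventually_lt_const (half_pos hε), h.eventually_pos] with κ h1 h2 hκ
  obtain ⟨hm, hN, -⟩ := hκ
  have hb := sum_min_cube_sq_le (J κ) (fun j => (x κ j : ℝ)) a b (Real.sqrt_pos.mpr hm)
    (by positivity : 0 ≤ (m κ : ℝ) / (J κ).card) (le_max_right K 1)
  refine hb.trans_lt ?_
  have h3 : ∑ j ∈ (J κ).filter (fun j => max K 1 < |(x κ j : ℝ)|), (x κ j : ℝ) ^ 2 ≤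
      ε / (2 * (M + 1)) * (J κ).card := by
    refine le_trans (Finset.sum_le_sum_of_subset_of_nonneg ?_ fun _ _ _ => sq_nonneg _) h1
    intro j hj
    rw [Finset.mem_filter] at hj ⊢
    exact ⟨hj.1, (le_max_left _ _).trans_lt hj.2⟩
  have h4 : (m κ : ℝ) / (J κ).card / √(m κ : ℝ) ^ 2 * M *
      ∑ j ∈ (J κ).filter (fun j => max K 1 < |(x κ j : ℝ)|), (x κ j : ℝ) ^ 2 ≤ ε / 2 := by
    rw [Real.sq_sqrt hm.le]
    calc _ ≤ (m κ : ℝ) / (J κ).card / (m κ) * M * (ε / (2 * (M + 1)) * (J κ).card) := by gcongr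
      _ = ε / 2 * (M / (M + 1)) := by field_simp
      _ ≤ ε / 2 * 1 := by
          gcongr
          exact (div_le_one (by positivity)).mpr (by linarith)
      _ = _ := mul_one _
  linarith

theorem tendsto_integrand (h : RegularPopulation x m v F J) (a b : ℝ) :
    Tendsto (fun κ => Complex.exp (Complex.I *
        (((b / √(m κ : ℝ) : ℝ) : ℂ) - m κ * ((a / √(m κ : ℝ) : ℝ) : ℂ))) *
      ∏ j ∈ J κ, bernoulliChar ((m κ : ℝ) / (J κ).card)
        (a / √(m κ : ℝ) + b / √(m κ : ℝ) * x κ j)) atTop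
      (𝓝 ((Real.exp (-(a ^ 2 + v * b ^ 2) / 2) : ℝ) : ℂ)) := by
  set s : ℕ → ℝ := fun κ => √(m κ : ℝ) with hs
  set r : ℕ → ℝ := fun κ => (m κ : ℝ) / (J κ).card with hr
  set θ : ∀ κ, α κ → ℝ := fun κ j => a / s κ + b / s κ * x κ j with hθ
  set A : ℕ → ℝ := fun κ => ∑ j ∈ J κ, r κ * θ κ j ^ 2 with hA
  set E : ℕ → ℂ := fun κ => Complex.I * (((b / s κ : ℝ) : ℂ) - m κ * ((a / s κ : ℝ) : ℂ)) +
    ∑ j ∈ J κ, r κ * (Complex.exp (Complex.I * θ κ j) - 1) with hE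
  have hAlim : Tendsto A atTop (𝓝 (a ^ 2 + v * b ^ 2)) := h.tendsto_sum_angle_sq a b
  have hRlim : Tendsto (fun κ => ∑ j ∈ J κ, (r κ : ℂ) * (Complex.exp (Complex.I * θ κ j) - 1 -
      Complex.I * θ κ j + (θ κ j : ℂ) ^ 2 / 2)) atTop (𝓝 0) := by
    have := (h.tendsto_sum_remainder a b).const_mul 4
    rw [mul_zero] at this
    refine squeeze_zero_norm' (Eventually.of_forall fun κ => ?_) this
    rw [Finset.mul_sum]
    refine norm_sum_le_of_le _ fun j _ => ?_
    have hr0 : 0 ≤ r κ := by positivity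
    rw [norm_mul, Complex.norm_real, Real.norm_of_nonneg hr0, mul_left_comm]
    exact mul_le_mul_of_nonneg_left (norm_exp_I_mul_sub_taylor_le _) hr0
  have hLlim : Tendsto (fun κ => (b / s κ) * (1 + r κ * ∑ j ∈ J κ, (x κ j : ℝ))) atTop
      (𝓝 0) := by
    obtain ⟨B, hB⟩ := h.sum_bounded
    have h1 : Tendsto (fun κ => |b| / s κ * (1 + 1 / 2 * B)) atTop (𝓝 (0 * (1 + 1 / 2 * B))) :=
      (tendsto_const_nhds.div_atTop h.tendsto_sqrt_sample).mul tendsto_const_nhds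
    rw [zero_mul] at h1
    refine squeeze_zero_norm' ?_ h1
    filter_upwards [hB, h.eventually_pos] with κ hκ hκ'
    obtain ⟨hm, hN, hr2⟩ := hκ'
    have hs0 : 0 ≤ s κ := Real.sqrt_nonneg _
    rw [norm_mul, norm_div, Real.norm_eq_abs, Real.norm_of_nonneg hs0]
    gcongr
    refine (norm_add_le _ _).trans ?_
    rw [norm_one, norm_mul, Real.norm_of_nonneg (by positivity : 0 ≤ r κ)]
    gcongr
    exact hκ
  have hElim : Tendsto E atTop (𝓝 ((-(a ^ 2 + v * b ^ 2) / 2 : ℝ) : ℂ)) := by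
    have h1 : Tendsto (fun κ => Complex.I *
        (((b / s κ) * (1 + r κ * ∑ j ∈ J κ, (x κ j : ℝ)) : ℝ) : ℂ) + ((-A κ / 2 : ℝ) : ℂ) +
        ∑ j ∈ J κ, (r κ : ℂ) * (Complex.exp (Complex.I * θ κ j) - 1 -
          Complex.I * θ κ j + (θ κ j : ℂ) ^ 2 / 2)) atTop
        (𝓝 (Complex.I * ((0 : ℝ) : ℂ) + ((-(a ^ 2 + v * b ^ 2) / 2 : ℝ) : ℂ) + 0)) := by
      refine Tendsto.add (Tendsto.add (Tendsto.const_mul _ ?_) ?_) hRlim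
      · exact (Complex.continuous_ofReal.tendsto _).comp hLlim
      · exact (Complex.continuous_ofReal.tendsto _).comp (hAlim.neg.div_const 2)
    rw [Complex.ofReal_zero, mul_zero, zero_add, add_zero] at h1
    refine h1.congr' ?_
    filter_upwards [h.eventually_pos] with κ hκ
    obtain ⟨hm, hN, -⟩ := hκ
    have hsum : ∑ j ∈ J κ, (r κ : ℂ) * (Complex.exp (Complex.I * θ κ j) - 1) =
        ∑ j ∈ J κ, (r κ : ℂ) * (Complex.exp (Complex.I * θ κ j) - 1 -
          Complex.I * θ κ j + (θ κ j : ℂ) ^ 2 / 2) +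
        Complex.I * ((∑ j ∈ J κ, r κ * θ κ j : ℝ) : ℂ) + ((-A κ / 2 : ℝ) : ℂ) := by
      simp only [hA]
      push_cast
      rw [Finset.mul_sum, ← Finset.sum_neg_distrib, Finset.sum_div, ← Finset.sum_add_distrib,
        ← Finset.sum_add_distrib]
      refine Finset.sum_congr rfl fun j _ => ?_
      ring
    have hlin : ∑ j ∈ J κ, r κ * θ κ j =
        m κ * (a / s κ) + b / s κ * (r κ * ∑ j ∈ J κ, (x κ j : ℝ)) := by
      simp only [hθ]
      rw [← Finset.mul_sum, Finset.sum_add_distrib, Finset.sum_const, ← Finset.mul_sum,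
        nsmul_eq_mul]
      have : r κ * (J κ).card = m κ := div_mul_cancel₀ _ hN.ne'
      linear_combination (a / s κ) * this
    simp only [hE]
    rw [hsum, hlin]
    push_cast
    ring
  have hD : Tendsto (fun κ => Complex.exp (Complex.I *
        (((b / s κ : ℝ) : ℂ) - m κ * ((a / s κ : ℝ) : ℂ))) *
      (∏ j ∈ J κ, bernoulliChar (r κ) (θ κ j) -
        Complex.exp (∑ j ∈ J κ, r κ * (Complex.exp (Complex.I * θ κ j) - 1)))) atTop (𝓝 0) := by
    have h1 := h.tendsto_ratio.mul hAlim
    rw [zero_mul] at h1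
    refine squeeze_zero_norm' ?_ h1
    filter_upwards [h.eventually_pos] with κ hκ
    rw [norm_mul]
    have : Complex.I * (((b / s κ : ℝ) : ℂ) - m κ * ((a / s κ : ℝ) : ℂ)) =
        ((b / s κ - m κ * (a / s κ) : ℝ) : ℂ) * Complex.I := by push_cast; ring
    rw [this, Complex.norm_exp_ofReal_mul_I, one_mul]
    exact norm_prod_bernoulliChar_sub_exp_le _ _ (by positivity) hκ.2.2
  have := hD.add ((Complex.continuous_exp.tendsto _).comp hElim)
  rw [zero_add, ← Complex.ofReal_exp] at this
  refine this.congr fun κ => ?_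
  simp only [hE, Function.comp_apply]
  rw [Complex.exp_add]
  ring

end RegularPopulation

/-- The quadratic lower bound satisfied by the characteristic function of a law charging each
point of `F`. -/
def Spreads (F : Finset ℤ) : Prop :=
  ∃ c > 0, ∀ u t : ℝ, |u| ≤ Real.pi → |t| ≤ Real.pi →
    c * (u ^ 2 + t ^ 2) ≤ ∑ i ∈ F, (1 - Real.cos (u + t * i))

theorem norm_prod_bernoulliChar_le {ι : Type*} (J : Finset ι) (x : ι → ℤ) (F : Finset ℤ)
    {r c b : ℝ} (h0 : 0 ≤ r) (h1 : r ≤ 1 / 2) (hc : 0 ≤ c)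
    (hJ : ∀ i ∈ F, c * J.card ≤ (J.filter fun j => x j = i).card)
    {u t : ℝ} (hF : b ≤ ∑ i ∈ F, (1 - Real.cos (u + t * i))) :
    ‖∏ j ∈ J, bernoulliChar r (u + t * x j)‖ ≤ Real.exp (-(r * J.card * (c / 2 * b))) := by
  have hcos : ∀ a : ℝ, 0 ≤ 1 - Real.cos a := fun a => by linarith [Real.cos_le_one a]
  rw [norm_prod]
  refine (Finset.prod_le_prod (fun _ _ => norm_nonneg _)
    fun j _ => norm_bernoulliChar_le r _).trans ?_
  rw [← Real.exp_sum, Real.exp_le_exp, Finset.sum_neg_distrib, neg_le_neg_iff, ← Finset.mul_sum]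
  have hsum : c * J.card * b ≤ ∑ j ∈ J, (1 - Real.cos (u + t * x j)) := by
    calc c * J.card * b ≤ c * J.card * ∑ i ∈ F, (1 - Real.cos (u + t * i)) := by gcongr
      _ ≤ ∑ i ∈ F, ∑ j ∈ J.filter (fun j => x j = i), (1 - Real.cos (u + t * x j)) := by
          rw [Finset.mul_sum]
          refine Finset.sum_le_sum fun i hi => ?_
          rw [Finset.sum_congr rfl fun j hj => by rw [(Finset.mem_filter.mp hj).2],
            Finset.sum_const, nsmul_eq_mul]
          exact mul_le_mul_of_nonneg_right (hJ i hi) (hcos _)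
      _ = ∑ j ∈ J.filter (fun j => x j ∈ F), (1 - Real.cos (u + t * x j)) := by
          rw [← Finset.sum_fiberwise_of_maps_to (g := x) (t := F)
            (fun j hj => (Finset.mem_filter.mp hj).2)]
          refine Finset.sum_congr rfl fun i hi => Finset.sum_congr ?_ fun _ _ => rfl
          ext j
          simp only [Finset.mem_filter]
          exact ⟨fun h => ⟨⟨h.1, h.2 ▸ hi⟩, h.2⟩, fun h => ⟨h.1.1, h.2⟩⟩
      _ ≤ _ := Finset.sum_le_sum_of_subset_of_nonneg (Finset.filter_subset _ _)
          fun _ _ _ => hcos _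
  have hs0 : 0 ≤ ∑ j ∈ J, (1 - Real.cos (u + t * x j)) := Finset.sum_nonneg fun _ _ => hcos _
  calc r * J.card * (c / 2 * b) = r * (1 / 2) * (c * J.card * b) := by ring
    _ ≤ r * (1 / 2) * ∑ j ∈ J, (1 - Real.cos (u + t * x j)) := by gcongr
    _ ≤ r * (1 - r) * ∑ j ∈ J, (1 - Real.cos (u + t * x j)) := by
        gcongr
        linarith

/-- The local limit theorem for the mode of the binomial distribution. -/
theorem tendsto_sqrt_mul_choose {m N : ℕ → ℕ} (hm : Tendsto m atTop atTop)
    (hN : Tendsto N atTop atTop) (hr : Tendsto (fun κ => (m κ : ℝ) / N κ) atTop (𝓝 0)) :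
    Tendsto (fun κ => √(m κ : ℝ) * ((N κ).choose (m κ) * ((m κ : ℝ) / N κ) ^ m κ *
      (1 - (m κ : ℝ) / N κ) ^ (N κ - m κ))) atTop (𝓝 (√(2 * Real.pi))⁻¹) := by
  have hev : ∀ᶠ κ in atTop, 0 < m κ ∧ m κ < N κ ∧ N κ ≤ 2 * (N κ - m κ) := by
    filter_upwards [hm.eventually_gt_atTop 0, hN.eventually_gt_atTop 0,
      hr.eventually_lt_const (by norm_num : (0 : ℝ) < 1 / 2)] with κ h1 h2 h3
    rw [div_lt_iff₀ (by exact_mod_cast h2)] at h3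
    have : 2 * m κ < N κ := by
      have : 2 * (m κ : ℝ) < N κ := by linarith
      exact_mod_cast this
    omega
  have hd : Tendsto (fun κ => N κ - m κ) atTop atTop := by
    refine tendsto_atTop.mpr fun b => ?_
    filter_upwards [hev, hN.eventually_ge_atTop (2 * b)] with κ h1 h2
    omega
  have hs := Stirling.tendsto_stirlingSeq_sqrt_pi
  have hpi : √Real.pi ≠ 0 := (Real.sqrt_pos.mpr Real.pi_pos).ne'
  have hlim : Tendsto (fun κ => Stirling.stirlingSeq (N κ) /
      (Stirling.stirlingSeq (m κ) * Stirling.stirlingSeq (N κ - m κ)) *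
      (√2 * √(1 - (m κ : ℝ) / N κ))⁻¹) atTop
      (𝓝 (√Real.pi / (√Real.pi * √Real.pi) * (√2 * √(1 - 0))⁻¹)) := by
    refine ((hs.comp hN).div ((hs.comp hm).mul (hs.comp hd)) (by positivity)).mul ?_
    refine Tendsto.inv₀ (tendsto_const_nhds.mul
      ((Real.continuous_sqrt.tendsto _).comp (tendsto_const_nhds.sub hr))) (by simp)
  have hval : √Real.pi / (√Real.pi * √Real.pi) * (√2 * √(1 - 0))⁻¹ = (√(2 * Real.pi))⁻¹ := by
    rw [Real.sqrt_mul (by norm_num), sub_zero, Real.sqrt_one, mul_one]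
    field_simp
  rw [hval] at hlim
  refine hlim.congr' ?_
  filter_upwards [hev] with κ hκ
  obtain ⟨hm0, hmN, -⟩ := hκ
  obtain ⟨l, hl⟩ := Nat.exists_eq_add_of_lt hmN
  have hNsub : N κ - m κ = l + 1 := by omega
  have hNe : N κ = m κ + (l + 1) := by omega
  rw [hNsub, Nat.cast_choose ℝ hmN.le, hNsub]
  have e1 : ∀ n : ℕ, 0 < n → (n.factorial : ℝ) =
      Stirling.stirlingSeq n * (√2 * √(n : ℝ) * ((n : ℝ) ^ n / Real.exp 1 ^ n)) := by
    intro n hn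
    have hn' : (0 : ℝ) < n := by exact_mod_cast hn
    rw [Stirling.stirlingSeq, ← Real.sqrt_mul (by norm_num), ← div_pow]
    field_simp
  rw [e1 _ (hm0.trans hmN), e1 _ hm0, e1 _ (Nat.succ_pos l)]
  have hmr : (0 : ℝ) < m κ := by exact_mod_cast hm0
  have hlr : (0 : ℝ) < ((l + 1 : ℕ) : ℝ) := by positivity
  have hNr : (0 : ℝ) < N κ := by exact_mod_cast hm0.trans hmN
  have h1r : 1 - (m κ : ℝ) / N κ = ((l + 1 : ℕ) : ℝ) / N κ := by
    rw [eq_div_iff hNr.ne', sub_mul, div_mul_cancel₀ _ hNr.ne', hNe]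
    push_cast
    ring
  have hS1 : Stirling.stirlingSeq (m κ) ≠ 0 := by
    obtain ⟨k, hk⟩ := Nat.exists_eq_succ_of_ne_zero hm0.ne'
    rw [hk]; exact (Stirling.stirlingSeq'_pos k).ne'
  have hS2 : Stirling.stirlingSeq (l + 1) ≠ 0 := (Stirling.stirlingSeq'_pos l).ne'
  rw [h1r, div_pow, div_pow, Real.sqrt_div hlr.le]
  have hexp : Real.exp 1 ^ N κ = Real.exp 1 ^ m κ * Real.exp 1 ^ (l + 1) := by
    rw [← pow_add, ← hNe]
  have hNp : (N κ : ℝ) ^ N κ = (N κ : ℝ) ^ m κ * (N κ : ℝ) ^ (l + 1) := by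
    rw [← pow_add, ← hNe]
  rw [hexp, hNp]
  have := Real.exp_pos 1
  have h2 := Real.sqrt_pos.mpr hmr
  have h3 := Real.sqrt_pos.mpr hlr
  have h4 := Real.sqrt_pos.mpr hNr
  generalize Stirling.stirlingSeq (N κ) = S0
  field_simp

namespace RegularPopulation

variable {α : ℕ → Type*} {x : ∀ κ, α κ → ℤ} {m : ℕ → ℕ} {v : ℝ} {F : Finset ℤ}
  {J : ∀ κ, Finset (α κ)}

theorem tendsto_fourier_integral (h : RegularPopulation x m v F J) (hv : 0 < v) (hF : Spreads F) :
    Tendsto (fun κ => (m κ : ℂ) * ∫ z in Set.Icc (-Real.pi) Real.pi ×ˢ Set.Icc (-Real.pi) Real.pi,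
      Complex.exp (Complex.I * ((z.2 : ℂ) - m κ * z.1)) *
        ∏ j ∈ J κ, bernoulliChar ((m κ : ℝ) / (J κ).card) (z.1 + z.2 * x κ j)) atTop
      (𝓝 ((2 * Real.pi / √v : ℝ) : ℂ)) := by
  set S : Set (ℝ × ℝ) := Set.Icc (-Real.pi) Real.pi ×ˢ Set.Icc (-Real.pi) Real.pi with hS
  have hSm : MeasurableSet S := measurableSet_Icc.prod measurableSet_Icc
  set f : ℕ → ℝ × ℝ → ℂ := fun κ z => Complex.exp (Complex.I * ((z.2 : ℂ) - m κ * z.1)) *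
        ∏ j ∈ J κ, bernoulliChar ((m κ : ℝ) / (J κ).card) (z.1 + z.2 * x κ j) with hf
  have hfc : ∀ κ, Continuous (f κ) := by
    intro κ
    refine Continuous.mul (by fun_prop) (continuous_finsetProd _ fun j _ => ?_)
    exact (continuous_bernoulliChar _).comp (by fun_prop)
  have hscale : ∀ᶠ κ in atTop, ∫ z, S.indicator (f κ) ((√(m κ : ℝ))⁻¹ • z) =
      (m κ : ℂ) * ∫ z in S, f κ z := by
    filter_upwards [h.eventually_pos] with κ hκ
    rw [Measure.integral_comp_smul, integral_indicator hSm]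
    have : Module.finrank ℝ (ℝ × ℝ) = 2 := by simp
    rw [this, inv_pow, inv_inv, Real.sq_sqrt hκ.1.le, abs_of_pos hκ.1, Complex.real_smul]
    simp
  have hgauss : ∫ z : ℝ × ℝ, ((Real.exp (-(z.1 ^ 2 + v * z.2 ^ 2) / 2) : ℝ) : ℂ) =
      ((2 * Real.pi / √v : ℝ) : ℂ) := by
    rw [integral_complex_ofReal]
    congr 1
    have h1 : ∀ z : ℝ × ℝ, Real.exp (-(z.1 ^ 2 + v * z.2 ^ 2) / 2) =
        Real.exp (-(1 / 2) * z.1 ^ 2) * Real.exp (-(v / 2) * z.2 ^ 2) := by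
      intro z
      rw [← Real.exp_add]
      congr 1
      ring
    simp only [h1]
    have := integral_prod_mul (μ := (volume : Measure ℝ)) (ν := (volume : Measure ℝ))
      (fun u : ℝ => Real.exp (-(1 / 2) * u ^ 2)) (fun t : ℝ => Real.exp (-(v / 2) * t ^ 2))
    rw [← Measure.volume_eq_prod] at this
    rw [this, integral_gaussian, integral_gaussian, ← Real.sqrt_mul (by positivity)]
    rw [show Real.pi / (1 / 2) * (Real.pi / (v / 2)) = (2 * Real.pi) ^ 2 / v by field_simp,
      Real.sqrt_div (by positivity), Real.sqrt_sq (by positivity)]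
  rw [← hgauss]
  refine Tendsto.congr' hscale ?_
  obtain ⟨b, hb, hbF⟩ := hF
  obtain ⟨c, hc, hcF⟩ := h.frequent
  refine tendsto_integral_filter_of_dominated_convergence
    (fun z : ℝ × ℝ => Real.exp (-(c / 2 * b) * z.1 ^ 2) * Real.exp (-(c / 2 * b) * z.2 ^ 2))
    ?_ ?_ ?_ ?_
  · refine Eventually.of_forall fun κ => Measurable.aestronglyMeasurable ?_
    exact ((hfc κ).measurable.indicator hSm).comp (measurable_const_smul _)
  · filter_upwards [h.eventually_pos, hcF] with κ hκ hcκ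
    refine Eventually.of_forall fun z => ?_
    by_cases hz : (√(m κ : ℝ))⁻¹ • z ∈ S
    swap
    · rw [Set.indicator_of_notMem hz, norm_zero]
      positivity
    rw [Set.indicator_of_mem hz]
    simp only [hf]
    set y := (√(m κ : ℝ))⁻¹ • z with hy
    have hexp : ‖Complex.exp (Complex.I * ((y.2 : ℂ) - m κ * y.1))‖ = 1 := by
      have : Complex.I * ((y.2 : ℂ) - m κ * y.1) = ((y.2 - m κ * y.1 : ℝ) : ℂ) * Complex.I := by
        push_cast; ring
      rw [this, Complex.norm_exp_ofReal_mul_I]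
    rw [norm_mul, hexp, one_mul]
    refine (norm_prod_bernoulliChar_le (J κ) (x κ) F (by positivity) hκ.2.2 hc.le hcκ
      (hbF y.1 y.2 (abs_le.mpr hz.1) (abs_le.mpr hz.2))).trans_eq ?_
    rw [← Real.exp_add]
    congr 1
    have hs : (√(m κ : ℝ))⁻¹ ^ 2 = (m κ : ℝ)⁻¹ := by rw [inv_pow, Real.sq_sqrt hκ.1.le]
    have hm0 := hκ.1.ne'
    have hN0 := hκ.2.1.ne'
    rw [hy, Prod.smul_fst, Prod.smul_snd, smul_eq_mul, smul_eq_mul, mul_pow, mul_pow, hs]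
    field_simp
    ring
  · have hg : Integrable fun u : ℝ => Real.exp (-(c / 2 * b) * u ^ 2) :=
      integrable_exp_neg_mul_sq (by positivity)
    exact hg.mul_prod hg
  · refine Eventually.of_forall fun z => ?_
    have hnhds : S ∈ 𝓝 (0 : ℝ × ℝ) := by
      rw [hS, ← Prod.mk_zero_zero]
      have := Real.pi_pos
      exact prod_mem_nhds (Icc_mem_nhds (by linarith) this) (Icc_mem_nhds (by linarith) this)
    have h0 : Tendsto (fun κ => (√(m κ : ℝ))⁻¹ • z) atTop (𝓝 0) := by
      have := (tendsto_inv_atTop_zero.comp h.tendsto_sqrt_sample).smul_const z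
      rwa [zero_smul] at this
    refine (h.tendsto_integrand z.1 z.2).congr' ?_
    filter_upwards [h0.eventually_mem hnhds] with κ hκ
    rw [Set.indicator_of_mem hκ]
    simp only [hf, Prod.smul_fst, Prod.smul_snd, smul_eq_mul, div_eq_inv_mul]

/-- The local limit theorem for the sum of a sample without replacement. -/
theorem tendsto_prob_sum_eq (h : RegularPopulation x m v F J) (hv : 0 < v) (hF : Spreads F) :
    Tendsto (fun κ => √(m κ : ℝ) *
      ((((J κ).powersetCard (m κ)).filter fun A => ∑ a ∈ A, x κ a = -1).card /
        ((J κ).card.choose (m κ) : ℝ))) atTop (𝓝 (√(2 * Real.pi * v))⁻¹) := by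
  have h1 := (h.tendsto_fourier_integral hv hF)
  simp only [fourier_card_subsets] at h1
  have h2 := (Complex.continuous_re.tendsto _).comp h1
  simp only [Function.comp_def, Complex.ofReal_re] at h2
  have h3 := h2.div ((tendsto_sqrt_mul_choose h.tendsto_sample h.tendsto_card h.tendsto_ratio).const_mul
    (4 * Real.pi ^ 2)) (by positivity)
  have hval : 2 * Real.pi / √v / (4 * Real.pi ^ 2 * (√(2 * Real.pi))⁻¹) =
      (√(2 * Real.pi * v))⁻¹ := by
    rw [Real.sqrt_mul (by positivity) v]
    have e1 : √(2 * Real.pi) ^ 2 = 2 * Real.pi := Real.sq_sqrt (by positivity)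
    have h4 := Real.sqrt_pos.mpr hv
    have h5 : 0 < √(2 * Real.pi) := by positivity
    generalize √(2 * Real.pi) = s at e1 h5
    rw [← e1, show 4 * Real.pi ^ 2 = (s ^ 2) ^ 2 by rw [e1]; ring]
    field_simp
  rw [hval] at h3
  refine h3.congr' ?_
  filter_upwards [h.eventually_pos] with κ hκ
  obtain ⟨hm, hN, hr⟩ := hκ
  have hmN : m κ ≤ (J κ).card := by
    have : (m κ : ℝ) ≤ (J κ).card := by
      rw [div_le_iff₀ hN] at hr
      linarith
    exact_mod_cast this
  have hch : (0 : ℝ) < ((J κ).card.choose (m κ) : ℝ) := by exact_mod_cast Nat.choose_pos hmN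
  have hr0 : 0 < (m κ : ℝ) / (J κ).card := by positivity
  have hr1 : 0 < 1 - (m κ : ℝ) / (J κ).card := by linarith
  have hs : √(m κ : ℝ) ^ 2 = m κ := Real.sq_sqrt hm.le
  have hs0 := Real.sqrt_pos.mpr hm
  simp only [Pi.div_apply]
  generalize (m κ : ℝ) / (J κ).card = r at hr0 hr1 ⊢
  rw [← Complex.ofReal_natCast, ← Complex.ofReal_mul, Complex.ofReal_re]
  have := Real.pi_pos
  generalize √(m κ : ℝ) = s at hs hs0 ⊢
  rw [← hs]
  field_simp

end RegularPopulation

namespace RegularPopulation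

variable {α : ℕ → Type*} {x : ∀ κ, α κ → ℤ} {m : ℕ → ℕ} {v : ℝ} {F : Finset ℤ}
  {J : ∀ κ, Finset (α κ)}

theorem tendsto_sum_sq_sample (h : RegularPopulation x m v F J) {R : ∀ κ, Finset (α κ)}
    (hR : ∀ᶠ κ in atTop, R κ ⊆ J κ ∧ (R κ).card = m κ) :
    Tendsto (fun κ => (∑ j ∈ R κ, (x κ j : ℝ) ^ 2) / (J κ).card) atTop (𝓝 0) := by
  refine tendsto_order.mpr ⟨fun y hy => Eventually.of_forall fun κ => hy.trans_le ?_, ?_⟩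
  · exact div_nonneg (Finset.sum_nonneg fun j _ => sq_nonneg _) (Nat.cast_nonneg _)
  intro ε hε
  obtain ⟨K, hK⟩ := h.tail (ε / 2) (by positivity)
  have hlim := h.tendsto_ratio.const_mul (K ^ 2)
  rw [mul_zero] at hlim
  filter_upwards [hK, hR, hlim.eventually_lt_const (half_pos hε), h.eventually_pos]
    with κ h1 h2 h3 hκ
  obtain ⟨-, hN, -⟩ := hκ
  have hle : ∑ j ∈ R κ, (x κ j : ℝ) ^ 2 ≤ K ^ 2 * m κ + ε / 2 * (J κ).card := by
    rw [← Finset.sum_filter_add_sum_filter_not (R κ) (fun j => K < |(x κ j : ℝ)|), add_comm]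
    refine add_le_add ?_ ?_
    · calc _ ≤ ∑ j ∈ (R κ).filter (fun j => ¬ K < |(x κ j : ℝ)|), K ^ 2 := by
            refine Finset.sum_le_sum fun j hj => ?_
            rw [← sq_abs]
            gcongr
            exact not_lt.mp (Finset.mem_filter.mp hj).2
        _ ≤ ∑ j ∈ R κ, K ^ 2 :=
            Finset.sum_le_sum_of_subset_of_nonneg (Finset.filter_subset _ _)
              fun _ _ _ => sq_nonneg _
        _ = _ := by rw [Finset.sum_const, h2.2, nsmul_eq_mul, mul_comm]
    · refine le_trans (Finset.sum_le_sum_of_subset_of_nonneg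
        (Finset.filter_subset_filter _ h2.1) fun _ _ _ => sq_nonneg _) h1
  rw [div_lt_iff₀ hN]
  have h4 : K ^ 2 * m κ < ε / 2 * (J κ).card := by
    rw [← mul_div_assoc, div_lt_iff₀ hN] at h3
    exact h3
  linarith

/-- Regularity is preserved when a sample with sum `-1` is removed. -/
theorem sdiff (h : RegularPopulation x m v F J) {R : ∀ κ, Finset (α κ)}
    (hR : ∀ᶠ κ in atTop, R κ ⊆ J κ ∧ (R κ).card = m κ ∧ ∑ j ∈ R κ, x κ j = -1) :
    RegularPopulation x m v F fun κ => J κ \ R κ := by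
  have hR' : ∀ᶠ κ in atTop, R κ ⊆ J κ ∧ (R κ).card = m κ := hR.mono fun κ h => ⟨h.1, h.2.1⟩
  have hcard : ∀ᶠ κ in atTop, ((J κ \ R κ).card : ℝ) = (J κ).card - m κ ∧
      ((J κ).card : ℝ) ≤ 2 * (J κ \ R κ).card := by
    filter_upwards [hR', h.eventually_pos] with κ h1 hκ
    have h2 : ((J κ \ R κ).card : ℝ) = (J κ).card - m κ := by
      rw [Finset.card_sdiff_of_subset h1.1, Nat.cast_sub (Finset.card_le_card h1.1), h1.2]
    refine ⟨h2, ?_⟩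
    have := (div_le_iff₀ hκ.2.1).mp hκ.2.2
    linarith
  have hq : Tendsto (fun κ => ((J κ).card : ℝ) / (J κ \ R κ).card) atTop (𝓝 1) := by
    have h1 : Tendsto (fun κ => (1 - (m κ : ℝ) / (J κ).card)⁻¹) atTop (𝓝 (1 - 0)⁻¹) :=
      (tendsto_const_nhds.sub h.tendsto_ratio).inv₀ (by norm_num)
    rw [sub_zero, inv_one] at h1
    refine h1.congr' ?_
    filter_upwards [hcard, h.eventually_pos] with κ h2 hκ
    rw [h2.1, ← div_self hκ.2.1.ne', ← sub_div, inv_div]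
  refine ⟨h.tendsto_sample, ?_, ?_, ?_, ?_, ?_, ?_⟩
  · refine tendsto_atTop.mpr fun b => ?_
    filter_upwards [hcard, h.tendsto_card.eventually_ge_atTop (2 * b)] with κ h1 h2
    have h3 : (J κ).card ≤ 2 * (J κ \ R κ).card := by exact_mod_cast h1.2
    omega
  · have h1 := h.tendsto_ratio.mul hq
    rw [zero_mul] at h1
    refine h1.congr' ?_
    filter_upwards [h.eventually_pos] with κ hκ
    exact div_mul_div_cancel₀ hκ.2.1.ne'
  · obtain ⟨B, hB⟩ := h.sum_bounded
    refine ⟨B + 1, ?_⟩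
    filter_upwards [hB, hR] with κ h1 h2
    have h3 := Finset.sum_sdiff h2.1 (f := fun j => (x κ j : ℝ))
    have h4 : ∑ j ∈ R κ, (x κ j : ℝ) = -1 := by exact_mod_cast h2.2.2
    rw [h4] at h3
    have h5 : ∑ j ∈ J κ \ R κ, (x κ j : ℝ) = ∑ j ∈ J κ, (x κ j : ℝ) + 1 := by linarith
    rw [h5]
    refine (abs_add_le _ _).trans ?_
    rw [abs_one]
    linarith
  · have h1 := (h.tendsto_sum_sq.sub (h.tendsto_sum_sq_sample hR')).mul hq
    rw [sub_zero, mul_one] at h1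
    refine h1.congr' ?_
    filter_upwards [hR', h.eventually_pos] with κ h2 hκ
    rw [← Finset.sum_sdiff h2.1, ← sub_div, add_sub_cancel_right]
    exact div_mul_div_cancel₀ hκ.2.1.ne'
  · intro ε hε
    obtain ⟨K, hK⟩ := h.tail (ε / 2) (half_pos hε)
    refine ⟨K, ?_⟩
    filter_upwards [hK, hcard] with κ h1 h2
    refine le_trans (Finset.sum_le_sum_of_subset_of_nonneg
      (Finset.filter_subset_filter _ Finset.sdiff_subset) fun _ _ _ => sq_nonneg _) (h1.trans ?_)
    nlinarith [h2.2]
  · obtain ⟨c, hc, hcF⟩ := h.frequent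
    refine ⟨c / 2, half_pos hc, ?_⟩
    filter_upwards [hcF, hR', hcard, h.tendsto_ratio.eventually_le_const (half_pos hc),
      h.eventually_pos] with κ h1 h2 h3 h4 hκ i hi
    rw [div_le_iff₀ hκ.2.1] at h4
    have h5 : ((J κ).filter fun j => x κ j = i).card ≤
        ((J κ \ R κ).filter fun j => x κ j = i).card + m κ := by
      rw [← h2.2]
      refine le_trans (Finset.card_le_card ?_) (Finset.card_union_le _ _)
      intro j hj
      simp only [Finset.mem_filter, Finset.mem_union, Finset.mem_sdiff] at hj ⊢
      by_cases hjR : j ∈ R κ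
      · exact Or.inr hjR
      · exact Or.inl ⟨⟨hj.1, hjR⟩, hj.2⟩
    have h6 : (((J κ).filter fun j => x κ j = i).card : ℝ) ≤
        ((J κ \ R κ).filter fun j => x κ j = i).card + m κ := by exact_mod_cast h5
    have h7 := h1 i hi
    rw [h3.1]
    have : 0 ≤ (m κ : ℝ) := Nat.cast_nonneg _
    nlinarith

/-- The probability that `q` successive disjoint samples all have sum `-1`. -/
theorem tendsto_blockCount [∀ κ, Fintype (α κ)] [∀ κ, NeZero (m κ)] (hv : 0 < v)
    (hF : Spreads F) (q : ℕ) : ∀ {J : ∀ κ, Finset (α κ)}, RegularPopulation x m v F J →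
    Tendsto (fun κ => √(m κ : ℝ) ^ q * (blockCount (x κ) (m κ) q (J κ) *
      ((J κ).card - q * m κ).factorial / (J κ).card.factorial)) atTop
      (𝓝 ((√(2 * Real.pi * v))⁻¹ ^ q)) := by
  induction q with
  | zero =>
    intro J _
    refine tendsto_const_nhds.congr fun κ => ?_
    have : ((J κ).card.factorial : ℝ) ≠ 0 := by positivity
    simp [blockCount_zero, this]
  | succ q ih =>
    intro J h
    set L := (√(2 * Real.pi * v))⁻¹ with hL
    have hL0 : 0 < L := by have := Real.pi_pos; positivity
    set H : ∀ κ, Finset (ZMod (m κ) → α κ) := fun κ =>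
      Finset.univ.filter fun h : ZMod (m κ) → α κ =>
        Function.Injective h ∧ (∀ b, h b ∈ J κ) ∧ ∑ b, x κ (h b) = -1 with hH
    set f : ∀ κ, Finset (α κ) → ℝ := fun κ A => √(m κ : ℝ) ^ q * (blockCount (x κ) (m κ) q A *
      (A.card - q * m κ).factorial / A.card.factorial) with hf
    set w : ℕ → ℝ := fun κ => √(m κ : ℝ) *
      (((J κ).card - m κ).factorial / (J κ).card.factorial) with hw
    have hmem : ∀ κ, ∀ g ∈ H κ, Finset.univ.image g ⊆ J κ ∧ (Finset.univ.image g).card = m κ ∧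
        ∑ j ∈ Finset.univ.image g, x κ j = -1 := by
      intro κ g hg
      simp only [hH, Finset.mem_filter, Finset.mem_univ, true_and] at hg
      refine ⟨?_, ?_, ?_⟩
      · intro j hj
        obtain ⟨b, -, rfl⟩ := Finset.mem_image.mp hj
        exact hg.2.1 b
      · rw [Finset.card_image_of_injective _ hg.1, Finset.card_univ, ZMod.card]
      · rw [Finset.sum_image fun a _ b _ hab => hg.1 hab]
        exact hg.2.2
    have hwH : Tendsto (fun κ => w κ * (H κ).card) atTop (𝓝 L) := by
      refine (h.tendsto_prob_sum_eq hv hF).congr' ?_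
      filter_upwards [h.eventually_pos] with κ hκ
      obtain ⟨hm, hN, hr⟩ := hκ
      have hmN : m κ ≤ (J κ).card := by
        have : (m κ : ℝ) ≤ (J κ).card := by
          rw [div_le_iff₀ hN] at hr
          linarith
        exact_mod_cast this
      have hc : (H κ).card = (((J κ).powersetCard (m κ)).filter fun A => ∑ a ∈ A, x κ a = -1).card *
          (m κ).factorial := by
        convert card_ordered_blocks (x κ) (m κ) (J κ)
      rw [hc, Nat.cast_choose ℝ hmN]
      have h1 : ((J κ).card.factorial : ℝ) ≠ 0 := by positivity
      have h2 : ((m κ).factorial : ℝ) ≠ 0 := by positivity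
      have h3 : (((J κ).card - m κ).factorial : ℝ) ≠ 0 := by positivity
      simp only [hw]
      push_cast
      field_simp
    have hne : ∀ᶠ κ in atTop, (H κ).Nonempty := by
      filter_upwards [hwH.eventually (lt_mem_nhds hL0)] with κ hκ
      rw [Finset.nonempty_iff_ne_empty]
      intro h0
      rw [h0] at hκ
      simp at hκ
    have hmax : ∀ κ, ∃ R : Finset (α κ), (H κ).Nonempty →
        (R ⊆ J κ ∧ R.card = m κ ∧ ∑ j ∈ R, x κ j = -1) ∧
        ∀ g ∈ H κ, |f κ (J κ \ Finset.univ.image g) - L ^ q| ≤ |f κ (J κ \ R) - L ^ q| := by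
      intro κ
      by_cases hn : (H κ).Nonempty
      · obtain ⟨g, hg, hgm⟩ := Finset.exists_max_image (H κ)
          (fun g => |f κ (J κ \ Finset.univ.image g) - L ^ q|) hn
        exact ⟨Finset.univ.image g, fun _ => ⟨hmem κ g hg, hgm⟩⟩
      · exact ⟨∅, fun h => absurd h hn⟩
    choose R hR using hmax
    have hreg := h.sdiff (hne.mono fun κ hκ => (hR κ hκ).1)
    have hlim := ((ih hreg).sub_const (L ^ q)).abs
    rw [sub_self, abs_zero] at hlim
    have hdiff : Tendsto (fun κ => ∑ g ∈ H κ, w κ * (f κ (J κ \ Finset.univ.image g) - L ^ q))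
        atTop (𝓝 0) := by
      have h1 := hwH.mul hlim
      rw [mul_zero] at h1
      refine squeeze_zero_norm' ?_ h1
      filter_upwards [hne] with κ hκ
      rw [mul_assoc, mul_left_comm, ← nsmul_eq_mul, ← Finset.sum_const]
      refine norm_sum_le_of_le _ fun g hg => ?_
      have hw0 : 0 ≤ w κ := by positivity
      rw [norm_mul, Real.norm_of_nonneg hw0]
      gcongr
      exact (hR κ hκ).2 g hg
    have htot := hdiff.add (hwH.mul_const (L ^ q))
    rw [zero_add, ← pow_succ'] at htot
    refine htot.congr fun κ => ?_
    have e1 : ∑ g ∈ H κ, w κ * (f κ (J κ \ Finset.univ.image g) - L ^ q) + w κ * (H κ).card * L ^ q =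
        ∑ g ∈ H κ, w κ * f κ (J κ \ Finset.univ.image g) := by
      simp only [mul_sub]
      rw [Finset.sum_sub_distrib, Finset.sum_const, nsmul_eq_mul]
      ring
    have e2 : blockCount (x κ) (m κ) (q + 1) (J κ) =
        ∑ g ∈ H κ, blockCount (x κ) (m κ) q (J κ \ Finset.univ.image g) := by
      convert blockCount_succ (x κ) (m κ) q (J κ)
    rw [e1, e2]
    push_cast
    rw [Finset.sum_mul, Finset.sum_div, Finset.mul_sum]
    refine Finset.sum_congr rfl fun g hg => ?_
    have hc : (J κ \ Finset.univ.image g).card = (J κ).card - m κ := by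
      rw [Finset.card_sdiff_of_subset (hmem κ g hg).1, (hmem κ g hg).2.1]
    have hc2 : (J κ).card - m κ - q * m κ = (J κ).card - (q + 1) * m κ := by
      rw [Nat.sub_sub, add_mul, one_mul, add_comm]
    simp only [hf, hw]
    rw [hc, hc2]
    have h1 : (((J κ).card - m κ).factorial : ℝ) ≠ 0 := by positivity
    have h2 : ((J κ).card.factorial : ℝ) ≠ 0 := by positivity
    field_simp
    ring

end RegularPopulation

theorem mul_norm_sq_le_one_sub_cos (y : ℝ) :
    2 / Real.pi ^ 2 * ‖(y : AddCircle (2 * Real.pi))‖ ^ 2 ≤ 1 - Real.cos y := by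
  have hp : (0 : ℝ) < 2 * Real.pi := by positivity
  set k : ℤ := round ((2 * Real.pi)⁻¹ * y) with hk
  have h1 : ‖(y : AddCircle (2 * Real.pi))‖ = |y - k * (2 * Real.pi)| := AddCircle.norm_eq _
  have h2 : |y - k * (2 * Real.pi)| ≤ Real.pi := by
    rw [← h1]
    have := AddCircle.norm_le_half_period (2 * Real.pi) (x := (y : AddCircle (2 * Real.pi))) hp.ne'
    rw [abs_of_pos hp] at this
    linarith
  have h3 := Real.cos_le_one_sub_mul_cos_sq h2
  rw [Real.cos_sub_int_mul_two_pi] at h3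
  rw [h1, sq_abs]
  linarith

/-- A set of integers whose differences generate `ℤ` contains a finite set that spreads. -/
theorem exists_finset_spreads {S : Set ℤ} {s : ℤ} (hs : s ∈ S)
    (hS : AddSubgroup.closure {z : ℤ | ∃ i ∈ S, ∃ j ∈ S, z = i - j} = ⊤) :
    ∃ F : Finset ℤ, (∀ i ∈ F, i ∈ S) ∧ Spreads F := by
  have hp : (0 : ℝ) < 2 * Real.pi := by positivity
  have hmono : ∀ {F G : Finset ℤ} (u t : ℝ), F ⊆ G →
      ∑ i ∈ F, ‖((u + t * i : ℝ) : AddCircle (2 * Real.pi))‖ ≤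
        ∑ i ∈ G, ‖((u + t * i : ℝ) : AddCircle (2 * Real.pi))‖ := fun u t h =>
    Finset.sum_le_sum_of_subset_of_nonneg h fun _ _ _ => norm_nonneg _
  have key : ∀ z ∈ AddSubgroup.closure {z : ℤ | ∃ i ∈ S, ∃ j ∈ S, z = i - j},
      ∃ F : Finset ℤ, (∀ i ∈ F, i ∈ S) ∧ ∃ C : ℝ, 0 ≤ C ∧ ∀ u t : ℝ,
        ‖((t * z : ℝ) : AddCircle (2 * Real.pi))‖ ≤
          C * ∑ i ∈ F, ‖((u + t * i : ℝ) : AddCircle (2 * Real.pi))‖ := by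
    intro z hz
    induction hz using AddSubgroup.closure_induction with
    | mem z hz =>
      obtain ⟨i, hi, j, hj, rfl⟩ := hz
      refine ⟨{i, j}, by simp [hi, hj], 2, by norm_num, fun u t => ?_⟩
      have h1 : ((t * ((i - j : ℤ) : ℝ) : ℝ) : AddCircle (2 * Real.pi)) =
          ((u + t * i : ℝ) : AddCircle (2 * Real.pi)) - ((u + t * j : ℝ) : AddCircle _) := by
        rw [← AddCircle.coe_sub]
        congr 1
        push_cast
        ring
      have h2 : ∀ k ∈ ({i, j} : Finset ℤ), ‖((u + t * k : ℝ) : AddCircle (2 * Real.pi))‖ ≤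
          ∑ i ∈ {i, j}, ‖((u + t * i : ℝ) : AddCircle (2 * Real.pi))‖ := fun k hk =>
        Finset.single_le_sum (f := fun i : ℤ => ‖((u + t * i : ℝ) : AddCircle (2 * Real.pi))‖)
          (fun _ _ => norm_nonneg _) hk
      rw [h1]
      refine (norm_sub_le _ _).trans ?_
      linarith [h2 i (by simp), h2 j (by simp)]
    | zero => exact ⟨∅, by simp, 0, le_rfl, by simp⟩
    | add y z _ _ hy hz =>
      obtain ⟨F, hF, C, hC, h⟩ := hy
      obtain ⟨G, hG, D, hD, h'⟩ := hz
      refine ⟨F ∪ G, fun i hi => (Finset.mem_union.mp hi).elim (hF i) (hG i), C + D,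
        add_nonneg hC hD, fun u t => ?_⟩
      have h1 : ((t * ((y + z : ℤ) : ℝ) : ℝ) : AddCircle (2 * Real.pi)) =
          ((t * y : ℝ) : AddCircle (2 * Real.pi)) + ((t * z : ℝ) : AddCircle _) := by
        rw [← AddCircle.coe_add]
        congr 1
        push_cast
        ring
      rw [h1, add_mul]
      exact (norm_add_le _ _).trans (add_le_add
        ((h u t).trans (mul_le_mul_of_nonneg_left (hmono u t Finset.subset_union_left) hC))
        ((h' u t).trans (mul_le_mul_of_nonneg_left (hmono u t Finset.subset_union_right) hD)))
    | neg z _ hz =>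
      obtain ⟨F, hF, C, hC, h⟩ := hz
      refine ⟨F, hF, C, hC, fun u t => ?_⟩
      have h1 : ((t * ((-z : ℤ) : ℝ) : ℝ) : AddCircle (2 * Real.pi)) =
          -((t * z : ℝ) : AddCircle (2 * Real.pi)) := by
        rw [← AddCircle.coe_neg]
        congr 1
        push_cast
        ring
      rw [h1, norm_neg]
      exact h u t
  obtain ⟨F, hF, C, hC, h⟩ := key 1 (hS ▸ AddSubgroup.mem_top _)
  refine ⟨insert s F, fun i hi => ?_, ?_⟩
  · rcases Finset.mem_insert.mp hi with rfl | hi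
    exacts [hs, hF i hi]
  set G := insert s F with hG
  have hGpos : (0 : ℝ) < G.card := by
    exact_mod_cast Finset.card_pos.mpr ⟨s, Finset.mem_insert_self _ _⟩
  set A : ℝ := C ^ 2 + (1 + |(s : ℝ)| * C) ^ 2 with hA
  have hA0 : 0 < A := by positivity
  refine ⟨2 / Real.pi ^ 2 / (A * G.card), by positivity, fun u t hu ht => ?_⟩
  have habs : ∀ y : ℝ, |y| ≤ Real.pi → ‖(y : AddCircle (2 * Real.pi))‖ = |y| := fun y hy => by
    rw [AddCircle.norm_coe_eq_abs_iff _ hp.ne', abs_of_pos hp]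
    linarith
  set W := ∑ i ∈ G, ‖((u + t * i : ℝ) : AddCircle (2 * Real.pi))‖ with hW
  have hW0 : 0 ≤ W := Finset.sum_nonneg fun _ _ => norm_nonneg _
  have htW : |t| ≤ C * W := by
    rw [← habs t ht]
    have := h u t
    rw [Int.cast_one, mul_one] at this
    exact this.trans (mul_le_mul_of_nonneg_left (hmono u t (Finset.subset_insert _ _)) hC)
  have huW : |u| ≤ (1 + |(s : ℝ)| * C) * W := by
    have h1 : ((u : ℝ) : AddCircle (2 * Real.pi)) =
        ((u + t * s : ℝ) : AddCircle (2 * Real.pi)) - s • ((t : ℝ) : AddCircle _) := by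
      rw [← AddCircle.coe_zsmul, ← AddCircle.coe_sub]
      congr 1
      rw [zsmul_eq_mul]
      ring
    have h2 : ‖((u + t * s : ℝ) : AddCircle (2 * Real.pi))‖ ≤ W :=
      Finset.single_le_sum (f := fun i : ℤ => ‖((u + t * i : ℝ) : AddCircle (2 * Real.pi))‖)
        (fun _ _ => norm_nonneg _) (Finset.mem_insert_self _ _)
    have h3 : ‖s • ((t : ℝ) : AddCircle (2 * Real.pi))‖ ≤ |(s : ℝ)| * |t| := by
      refine (norm_zsmul_le _ _).trans ?_
      rw [habs t ht, Int.norm_eq_abs]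
    calc |u| = ‖((u : ℝ) : AddCircle (2 * Real.pi))‖ := (habs u hu).symm
      _ ≤ W + |(s : ℝ)| * |t| := by
          rw [h1]
          exact (norm_sub_le _ _).trans (add_le_add h2 h3)
      _ ≤ W + |(s : ℝ)| * (C * W) := by gcongr
      _ = _ := by ring
  have hsum : u ^ 2 + t ^ 2 ≤ A * W ^ 2 := by
    have h1 := pow_le_pow_left₀ (abs_nonneg _) htW 2
    have h2 := pow_le_pow_left₀ (abs_nonneg _) huW 2
    rw [sq_abs] at h1 h2
    rw [hA]
    nlinarith
  have hcs : W ^ 2 ≤ G.card * ∑ i ∈ G, ‖((u + t * i : ℝ) : AddCircle (2 * Real.pi))‖ ^ 2 :=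
    sq_sum_le_card_mul_sum_sq
  calc 2 / Real.pi ^ 2 / (A * G.card) * (u ^ 2 + t ^ 2)
      ≤ 2 / Real.pi ^ 2 / (A * G.card) * (A * (G.card *
          ∑ i ∈ G, ‖((u + t * i : ℝ) : AddCircle (2 * Real.pi))‖ ^ 2)) := by
        gcongr
        exact hsum.trans (by gcongr)
    _ = ∑ i ∈ G, 2 / Real.pi ^ 2 * ‖((u + t * i : ℝ) : AddCircle (2 * Real.pi))‖ ^ 2 := by
        rw [← Finset.mul_sum]
        field_simp
    _ ≤ _ := Finset.sum_le_sum fun i _ => mul_norm_sq_le_one_sub_cos _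

theorem Nonlattice.closure_sub_eq_top {p : ℕ → ℝ} (hp : Nonlattice p) {S : Set ℤ}
    (hS : ∀ k : ℕ, 0 < p k → (k : ℤ) - 1 ∈ S) :
    AddSubgroup.closure {z : ℤ | ∃ i ∈ S, ∃ j ∈ S, z = i - j} = ⊤ := by
  obtain ⟨g, hg⟩ := Int.subgroup_cyclic
    (AddSubgroup.closure {z : ℤ | ∃ i ∈ S, ∃ j ∈ S, z = i - j})
  have h1 : g.natAbs = 1 := hp _ fun i j hi hj => by
    rw [Int.natAbs_dvd, ← Int.mem_zmultiples_iff, AddSubgroup.zmultiples_eq_closure, ← hg]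
    exact AddSubgroup.subset_closure ⟨_, hS i hi, _, hS j hj, by ring⟩
  rw [hg, ← AddSubgroup.zmultiples_eq_closure, eq_top_iff]
  intro z _
  rw [Int.mem_zmultiples_iff, ← Int.natAbs_dvd, h1]
  exact one_dvd _

/-- The increments of a nonlattice offspring law contain a finite set that spreads. -/
theorem Nonlattice.exists_finset_spreads {p : ℕ → ℝ} (hp : Nonlattice p) :
    ∃ F : Finset ℤ, (∀ i ∈ F, ∃ k : ℕ, 0 < p k ∧ (k : ℤ) - 1 = i) ∧ Spreads F := by
  obtain ⟨k, hk⟩ : ∃ k, 0 < p k := by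
    by_contra! h
    have := hp 0 fun i _ hi _ => absurd hi (h i).not_gt
    omega
  exact _root_.exists_finset_spreads (S := {i | ∃ k : ℕ, 0 < p k ∧ (k : ℤ) - 1 = i})
    ⟨k, hk, rfl⟩ (hp.closure_sub_eq_top fun k hk => ⟨k, hk, rfl⟩)

theorem Multiset.exists_map_univ_eq {α β : Type*} [Fintype α] (s : Multiset β)
    (hs : Multiset.card s = Fintype.card α) : ∃ d : α → β, Finset.univ.val.map d = s := by
  have e : α ≃ s.ToType := Fintype.equivOfCardEq (by rw [Multiset.card_coe, hs])
  refine ⟨fun a => (e a).1, ?_⟩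
  rw [← Function.comp_def (fun y : s.ToType => y.1) e, ← Multiset.map_map,
    Multiset.map_univ_val_equiv, Multiset.map_univ_coe]

theorem sum_comp_eq_finsupp_sum {α β M : Type*} [Fintype α] [AddCommMonoid M] {n : β →₀ ℕ}
    {d : α → β} (hd : Finset.univ.val.map d = Finsupp.toMultiset n) (f : β → M) :
    ∑ i, f (d i) = n.sum fun k c => c • f k := by
  have h1 : ∑ i, f (d i) = ((Finset.univ.val.map d).map f).sum := by
    rw [Multiset.map_map]
    rfl
  rw [h1, hd, Finset.sum_multiset_map_count, Finsupp.toFinset_toMultiset, Finsupp.sum]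
  exact Finset.sum_congr rfl fun k _ => by rw [Finsupp.count_toMultiset]

section Tails

variable {w g h : ℕ → ℝ} {K : ℕ}

theorem summable_mul_of_abs_le (hw : ∀ i, 0 ≤ w i) (hs : Summable fun i => h i * w i)
    (hgh : ∀ i, K ≤ i → |g i| ≤ h i) : Summable fun i => g i * w i := by
  rw [← summable_nat_add_iff K]
  refine Summable.of_norm_bounded ((summable_nat_add_iff K).mpr hs) fun i => ?_
  rw [norm_mul, Real.norm_eq_abs, Real.norm_of_nonneg (hw _)]
  exact mul_le_mul_of_nonneg_right (hgh _ (Nat.le_add_left _ _)) (hw _)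

theorem abs_tsum_sub_sum_range_le (hw : ∀ i, 0 ≤ w i) (hs : Summable fun i => h i * w i)
    (hgh : ∀ i, K ≤ i → |g i| ≤ h i) :
    |∑' i, g i * w i - ∑ i ∈ Finset.range K, g i * w i| ≤
      ∑' i, h i * w i - ∑ i ∈ Finset.range K, h i * w i := by
  rw [← (summable_mul_of_abs_le hw hs hgh).sum_add_tsum_nat_add K, ← hs.sum_add_tsum_nat_add K,
    add_sub_cancel_left, add_sub_cancel_left, ← Real.norm_eq_abs]
  refine tsum_of_norm_bounded ((summable_nat_add_iff K).mpr hs).hasSum fun i => ?_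
  rw [norm_mul, Real.norm_eq_abs, Real.norm_of_nonneg (hw _)]
  exact mul_le_mul_of_nonneg_right (hgh _ (Nat.le_add_left _ _)) (hw _)

theorem exists_eventually_tail_le {W : ℕ → ℕ → ℝ}
    (hW : ∀ i, Tendsto (fun κ => W κ i) atTop (𝓝 (w i)))
    (hs : Summable fun i => h i * w i)
    (hlim : Tendsto (fun κ => ∑' i, h i * W κ i) atTop (𝓝 (∑' i, h i * w i)))
    (L : ℕ) {ε : ℝ} (hε : 0 < ε) :
    ∃ K, L ≤ K ∧ ∑' i, h i * w i - ∑ i ∈ Finset.range K, h i * w i < ε ∧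
      ∀ᶠ κ in atTop, ∑' i, h i * W κ i - ∑ i ∈ Finset.range K, h i * W κ i < ε := by
  have h1 := (tendsto_const_nhds (x := ∑' i, h i * w i)).sub hs.hasSum.tendsto_sum_nat
  rw [sub_self] at h1
  obtain ⟨K, hK, hLK⟩ := ((h1.eventually_lt_const hε).and (eventually_ge_atTop L)).exists
  exact ⟨K, hLK, hK, (hlim.sub (tendsto_finsetSum _ fun i _ =>
    (hW i).const_mul (h i))).eventually_lt_const hK⟩

theorem tendsto_tsum_mul_of_abs_le {W : ℕ → ℕ → ℝ}
    (hW : ∀ i, Tendsto (fun κ => W κ i) atTop (𝓝 (w i)))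
    (hs : Summable fun i => h i * w i)
    (hlim : Tendsto (fun κ => ∑' i, h i * W κ i) atTop (𝓝 (∑' i, h i * w i)))
    (hw : ∀ i, 0 ≤ w i) (hW0 : ∀ κ i, 0 ≤ W κ i)
    (hWs : ∀ κ, Summable fun i => h i * W κ i) {L : ℕ} (hgh : ∀ i, L ≤ i → |g i| ≤ h i) :
    Tendsto (fun κ => ∑' i, g i * W κ i) atTop (𝓝 (∑' i, g i * w i)) := by
  refine Metric.tendsto_nhds.mpr fun ε hε => ?_
  obtain ⟨K, hLK, hK, hKW⟩ := exists_eventually_tail_le hW hs hlim L (by positivity : 0 < ε / 3)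
  have hfin : Tendsto (fun κ => ∑ i ∈ Finset.range K, g i * W κ i) atTop
      (𝓝 (∑ i ∈ Finset.range K, g i * w i)) :=
    tendsto_finsetSum _ fun i _ => (hW i).const_mul (g i)
  filter_upwards [hKW, Metric.tendsto_nhds.mp hfin (ε / 3) (by positivity)] with κ h1 h2
  have h3 := abs_tsum_sub_sum_range_le (hW0 κ) (hWs κ) fun i hi => hgh i (hLK.trans hi)
  have h4 := abs_tsum_sub_sum_range_le hw hs fun i hi => hgh i (hLK.trans hi)
  rw [Real.dist_eq] at h2 ⊢
  rw [abs_lt] at h2 ⊢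
  rw [abs_le] at h3 h4
  constructor <;> linarith [h2.1, h2.2, h3.1, h3.2, h4.1, h4.2]

end Tails

theorem summable_mul_empDist (n : ℕ →₀ ℕ) (f : ℕ → ℝ) : Summable fun i => f i * empDist n i :=
  summable_of_ne_finset_zero (s := n.support) fun i hi => by
    rw [empDist, Finsupp.notMem_support_iff.mp hi, Nat.cast_zero, zero_div, mul_zero]

theorem empDist_nonneg (n : ℕ →₀ ℕ) (i : ℕ) : 0 ≤ empDist n i := by
  unfold empDist
  positivity

theorem sum_comp_eq_nsize_mul_tsum {α : Type*} [Fintype α] {n : ℕ →₀ ℕ} {d : α → ℕ}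
    (hd : Finset.univ.val.map d = Finsupp.toMultiset n) (hn : nsize n ≠ 0) (f : ℕ → ℝ) :
    ∑ j, f (d j) = nsize n * ∑' i, f i * empDist n i := by
  rw [sum_comp_eq_finsupp_sum hd, tsum_eq_sum (s := n.support), Finset.mul_sum, Finsupp.sum]
  · refine Finset.sum_congr rfl fun i _ => ?_
    have : (nsize n : ℝ) ≠ 0 := by exact_mod_cast hn
    rw [empDist, nsmul_eq_mul]
    field_simp
  · intro i hi
    rw [empDist, Finsupp.notMem_support_iff.mp hi, Nat.cast_zero, zero_div, mul_zero]

theorem card_filter_eq_apply {α : Type*} [Fintype α] {n : ℕ →₀ ℕ} {d : α → ℕ}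
    (hd : Finset.univ.val.map d = Finsupp.toMultiset n) (k : ℕ) :
    (Finset.univ.filter fun j => d j = k).card = n k := by
  rw [Finset.card_filter, sum_comp_eq_finsupp_sum hd fun i => if i = k then 1 else 0]
  simpa [Finsupp.sum] using Eq.symm

/-- The total of the increments along a degree statistic. -/
theorem IsDegStat.sum_sub_one {α : Type*} [Fintype α] {n : ℕ →₀ ℕ} (hn : IsDegStat n) {d : α → ℕ}
    (hd : Finset.univ.val.map d = Finsupp.toMultiset n) : ∑ j, ((d j : ℤ) - 1) = -1 := by
  have h1 := sum_comp_eq_finsupp_sum hd fun i => (i : ℤ)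
  have h2 := sum_comp_eq_finsupp_sum hd fun _ => (1 : ℤ)
  have h3 : ((n.sum fun _ c => c : ℕ) : ℤ) = 1 + ((n.sum fun i c => i * c : ℕ) : ℤ) := by
    exact_mod_cast hn
  rw [Finset.sum_sub_distrib, h1, h2]
  simp only [Finsupp.sum, nsmul_eq_mul] at h3 ⊢
  push_cast at h3
  simp only [mul_comm ((n _ : ℕ) : ℤ), one_mul] at h3 ⊢
  linarith

theorem abs_sub_one_sq_le {i : ℕ} (hi : 1 ≤ i) : |((i : ℝ) - 1) ^ 2| ≤ (i : ℝ) ^ 2 := by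
  have : (1 : ℝ) ≤ i := by exact_mod_cast hi
  rw [abs_of_nonneg (sq_nonneg _)]
  nlinarith

section Conditions

variable {nseq : ℕ → (ℕ →₀ ℕ)} {p : ℕ → ℝ}

theorem Nonlattice.sigmaSq_pos (hnl : Nonlattice p) (h1 : Condition1 nseq p)
    (h2 : Condition2 nseq p) : 0 < sigmaSq p := by
  obtain ⟨k, hk, hpk⟩ : ∃ k, k ≠ 1 ∧ 0 < p k := by
    by_contra! h
    have h' : ∀ i, 0 < p i → i = 1 := fun i hi => by
      by_contra hne
      exact (h i hne).not_gt hi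
    have := hnl 0 fun i j hi hj => by rw [h' i hi, h' j hj]; simp
    omega
  have hs := summable_mul_of_abs_le (g := fun i => ((i : ℝ) - 1) ^ 2) h1.2.2.1 h2.1
    fun i hi => abs_sub_one_sq_le hi
  refine hs.tsum_pos (fun i => mul_nonneg (sq_nonneg _) (h1.2.2.1 i)) k (mul_pos ?_ hpk)
  have : (k : ℝ) - 1 ≠ 0 := sub_ne_zero.mpr (by exact_mod_cast hk)
  positivity

/-- The increments of degree statistics satisfying the two conditions are a regular population. -/
theorem regularPopulation_of_conditions (h1 : Condition1 nseq p) (h2 : Condition2 nseq p)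
    {m : ℕ → ℕ} (hm : Tendsto m atTop atTop)
    (hr : Tendsto (fun κ => (m κ : ℝ) / nsize (nseq κ)) atTop (𝓝 0))
    {F : Finset ℤ} (hF : ∀ i ∈ F, ∃ k : ℕ, 0 < p k ∧ (k : ℤ) - 1 = i)
    {α : ℕ → Type*} [∀ κ, Fintype (α κ)] (hcard : ∀ κ, Fintype.card (α κ) = nsize (nseq κ))
    {d : ∀ κ, α κ → ℕ} (hd : ∀ κ, Finset.univ.val.map (d κ) = Finsupp.toMultiset (nseq κ)) :
    RegularPopulation (fun κ j => (d κ j : ℤ) - 1) m (sigmaSq p) F fun κ =>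
      (Finset.univ : Finset (α κ)) := by
  obtain ⟨hdeg, hN, hp0, -, hp⟩ := h1
  obtain ⟨hs, hlim⟩ := h2
  have hNpos := hN.eventually_gt_atTop 0
  refine ⟨hm, ?_, ?_, ⟨1, Eventually.of_forall fun κ => ?_⟩, ?_, fun ε hε => ?_, ?_⟩
  · simpa only [Finset.card_univ, hcard] using hN
  · simpa only [Finset.card_univ, hcard] using hr
  · rw [← Int.cast_sum, (hdeg κ).sum_sub_one (hd κ)]
    simp
  · refine (tendsto_tsum_mul_of_abs_le (g := fun i => ((i : ℝ) - 1) ^ 2) hp hs hlim hp0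
      (fun κ => empDist_nonneg _) (fun κ => summable_mul_empDist _ _)
      fun i hi => abs_sub_one_sq_le hi).congr' ?_
    filter_upwards [hNpos] with κ hκ
    have h3 := sum_comp_eq_nsize_mul_tsum (hd κ) hκ.ne' fun i => ((i : ℝ) - 1) ^ 2
    have : (nsize (nseq κ) : ℝ) ≠ 0 := by exact_mod_cast hκ.ne'
    push_cast
    rw [h3, Finset.card_univ, hcard, mul_div_cancel_left₀ _ this]
  · obtain ⟨K, hK1, -, hK⟩ := exists_eventually_tail_le hp hs hlim 1 hε
    refine ⟨K, ?_⟩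
    filter_upwards [hNpos, hK] with κ hκ hκK
    set f : ℕ → ℝ := fun i => if (K : ℝ) < |(i : ℝ) - 1| then ((i : ℝ) - 1) ^ 2 else 0 with hf
    have hfK : ∀ i < K, f i = 0 := fun i hi => by
      have h3 : (i : ℝ) + 1 ≤ K := by exact_mod_cast hi
      have h4 : (0 : ℝ) ≤ i := Nat.cast_nonneg i
      rw [hf]
      refine if_neg (not_lt.mpr (abs_le.mpr ⟨?_, ?_⟩)) <;> linarith [(Nat.one_le_cast (α := ℝ)).mpr hK1]
    have hfle : ∀ i, K ≤ i → |f i| ≤ (i : ℝ) ^ 2 := fun i hi => by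
      simp only [hf]
      split_ifs
      · exact abs_sub_one_sq_le (hK1.trans hi)
      · rw [abs_zero]
        positivity
    have h3 := abs_tsum_sub_sum_range_le (empDist_nonneg (nseq κ)) (summable_mul_empDist _ _) hfle
    rw [Finset.sum_eq_zero fun i hi => by rw [hfK i (Finset.mem_range.mp hi), zero_mul],
      sub_zero] at h3
    have h4 := sum_comp_eq_nsize_mul_tsum (hd κ) hκ.ne' f
    rw [Finset.sum_filter, Finset.card_univ, hcard, mul_comm ε]
    push_cast
    rw [h4]
    exact mul_le_mul_of_nonneg_left ((le_abs_self _).trans (h3.trans hκK.le)) (Nat.cast_nonneg _)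
  · choose! k hk hki using hF
    have hc : ∀ᶠ c in 𝓝[>] (0 : ℝ), ∀ i ∈ F, c < p (k i) :=
      (Filter.eventually_all_finset F).mpr fun i hi =>
        (eventually_lt_nhds (hk i hi)).filter_mono nhdsWithin_le_nhds
    obtain ⟨c, hc, hc0⟩ := (hc.and self_mem_nhdsWithin).exists
    refine ⟨c, hc0, ?_⟩
    have hev : ∀ᶠ κ in atTop, ∀ i ∈ F, c < empDist (nseq κ) (k i) :=
      (Filter.eventually_all_finset F).mpr fun i hi => (hp _).eventually_const_lt (hc i hi)
    filter_upwards [hev, hNpos] with κ hκ hκN i hi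
    have h3 := hκ i hi
    rw [empDist, lt_div_iff₀ (by exact_mod_cast hκN)] at h3
    rw [Finset.card_univ, hcard]
    refine h3.le.trans (le_of_eq ?_)
    rw [← card_filter_eq_apply (hd κ) (k i)]
    congr 2
    ext j
    simp only [Finset.mem_filter, Finset.mem_univ, true_and]
    have := hki i hi
    omega

end Conditions

section Scaling

variable {m N : ℕ → ℕ} {a : ℝ}

theorem tendsto_atTop_of_div_rpow (hN : Tendsto N atTop atTop)
    (hm : Tendsto (fun κ => (m κ : ℝ) / (N κ : ℝ) ^ ((2 : ℝ) / 3)) atTop (𝓝 a)) (ha : 0 < a) :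
    Tendsto m atTop atTop := by
  rw [← tendsto_natCast_atTop_iff (R := ℝ)]
  have h1 : Tendsto (fun κ => (N κ : ℝ) ^ ((2 : ℝ) / 3)) atTop atTop :=
    (tendsto_rpow_atTop (by norm_num)).comp (tendsto_natCast_atTop_iff.mpr hN)
  refine (hm.pos_mul_atTop ha h1).congr' ?_
  filter_upwards [h1.eventually_gt_atTop 0] with κ hκ
  exact div_mul_cancel₀ _ hκ.ne'

theorem tendsto_div_zero_of_div_rpow (hN : Tendsto N atTop atTop)
    (hm : Tendsto (fun κ => (m κ : ℝ) / (N κ : ℝ) ^ ((2 : ℝ) / 3)) atTop (𝓝 a)) :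
    Tendsto (fun κ => (m κ : ℝ) / N κ) atTop (𝓝 0) := by
  have h1 : Tendsto (fun κ => (N κ : ℝ) ^ (-((1 : ℝ) / 3))) atTop (𝓝 0) :=
    (tendsto_rpow_neg_atTop (by norm_num)).comp (tendsto_natCast_atTop_iff.mpr hN)
  have h2 := hm.mul h1
  rw [mul_zero] at h2
  refine h2.congr' ?_
  filter_upwards [hN.eventually_gt_atTop 0] with κ hκ
  have hκ : (0 : ℝ) < N κ := by exact_mod_cast hκ
  have h3 : (N κ : ℝ) ^ ((2 : ℝ) / 3) * (N κ : ℝ) ^ ((1 : ℝ) / 3) = N κ := by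
    rw [← Real.rpow_add hκ]
    norm_num
  have h4 : (N κ : ℝ) ^ ((2 : ℝ) / 3) ≠ 0 := by positivity
  have h5 : (N κ : ℝ) ^ ((1 : ℝ) / 3) ≠ 0 := by positivity
  rw [Real.rpow_neg hκ.le]
  nth_rewrite 3 [← h3]
  field_simp

theorem tendsto_div_mul_sqrt_of_div_rpow (hN : Tendsto N atTop atTop)
    (hm : Tendsto (fun κ => (m κ : ℝ) / (N κ : ℝ) ^ ((2 : ℝ) / 3)) atTop (𝓝 a)) (ha : 0 < a) :
    Tendsto (fun κ => (N κ : ℝ) / (m κ * √(m κ))) atTop (𝓝 (a * √a)⁻¹) := by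
  refine ((hm.mul hm.sqrt).inv₀ (by positivity)).congr' ?_
  filter_upwards [hN.eventually_gt_atTop 0] with κ hκ
  have hκ : (0 : ℝ) < N κ := by exact_mod_cast hκ
  have h3 : (N κ : ℝ) ^ ((2 : ℝ) / 3) * √((N κ : ℝ) ^ ((2 : ℝ) / 3)) = N κ := by
    rw [Real.sqrt_eq_rpow, ← Real.rpow_mul hκ.le, ← Real.rpow_add hκ]
    norm_num
  rw [Real.sqrt_div (Nat.cast_nonneg _), div_mul_div_comm, h3, inv_div]

end Scaling

/-- Almost all tuples of `q` windows of a relatively short length are disjoint. -/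
theorem tendsto_card_injective_windowPos {m N : ℕ → ℕ} [∀ κ, NeZero (N κ)] [∀ κ, NeZero (m κ)]
    (hmN : ∀ κ, m κ ≤ N κ) (hr : Tendsto (fun κ => (m κ : ℝ) / N κ) atTop (𝓝 0)) (q : ℕ) :
    Tendsto (fun κ => ((Finset.univ.filter fun e : Fin q → ZMod (N κ) =>
      Function.Injective (windowPos (m κ) e)).card : ℝ) / (N κ : ℝ) ^ q) atTop (𝓝 1) := by
  have h1 : Tendsto (fun κ => ((Finset.univ.filter fun e : Fin q → ZMod (N κ) =>
      ¬ Function.Injective (windowPos (m κ) e)).card : ℝ) / (N κ : ℝ) ^ q) atTop (𝓝 0) := by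
    have h2 := hr.const_mul ((q : ℝ) * q)
    rw [mul_zero] at h2
    refine squeeze_zero (fun κ => by positivity) (fun κ => ?_) h2
    have hNκ : (0 : ℝ) < N κ := by exact_mod_cast Nat.pos_of_ne_zero (NeZero.ne (N κ))
    have h3 : (N κ : ℝ) * (Finset.univ.filter fun e : Fin q → ZMod (N κ) =>
        ¬ Function.Injective (windowPos (m κ) e)).card ≤ q * q * m κ * N κ ^ q := by
      exact_mod_cast card_not_injective_windowPos_le (hmN κ) q
    rw [← mul_div_assoc, div_le_div_iff₀ (by positivity) hNκ]
    linarith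
  have h4 := h1.const_sub 1
  rw [sub_zero] at h4
  refine h4.congr fun κ => ?_
  have hNκ : (N κ : ℝ) ≠ 0 := by exact_mod_cast NeZero.ne (N κ)
  have h5 := Finset.card_filter_add_card_filter_not (s := (Finset.univ : Finset (Fin q → ZMod (N κ))))
    (fun e => Function.Injective (windowPos (m κ) e))
  rw [Finset.card_univ, Fintype.card_fun, ZMod.card, Fintype.card_fin] at h5
  have h6 : ((Finset.univ.filter fun e : Fin q → ZMod (N κ) =>
      Function.Injective (windowPos (m κ) e)).card : ℝ) + (Finset.univ.filter
        fun e : Fin q → ZMod (N κ) => ¬ Function.Injective (windowPos (m κ) e)).card =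
      (N κ : ℝ) ^ q := by exact_mod_cast h5
  rw [eq_div_iff (by positivity), sub_mul, div_mul_cancel₀ _ (by positivity)]
  linarith

theorem tendsto_factorialMoment_cyclicCount {m N : ℕ → ℕ} [∀ κ, NeZero (N κ)]
    [∀ κ, NeZero (m κ)] (hmN : ∀ κ, m κ ≤ N κ) {a v : ℝ} (ha : 0 < a) (hv : 0 < v)
    (hs : Tendsto (fun κ => (N κ : ℝ) / (m κ * √(m κ))) atTop (𝓝 (a * √a)⁻¹))
    {x : ∀ κ, ZMod (N κ) → ℤ} {F : Finset ℤ} (hF : Spreads F)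
    (hx : RegularPopulation x m v F fun κ => (Finset.univ : Finset (ZMod (N κ)))) (q : ℕ) :
    Tendsto (fun κ => (∑ σ : Equiv.Perm (ZMod (N κ)),
        ((cyclicCount (m κ) (x κ ∘ σ)).descFactorial q : ℝ)) /
        Fintype.card (Equiv.Perm (ZMod (N κ)))) atTop
      (𝓝 ((√(2 * Real.pi * v * a ^ 3))⁻¹ ^ q)) := by
  have hr := hx.tendsto_ratio
  simp only [Finset.card_univ, ZMod.card] at hr
  have h1 := ((tendsto_card_injective_windowPos hmN hr q).mul (hs.pow q)).mul
    (hx.tendsto_blockCount hv hF q)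
  have hlim : 1 * (a * √a)⁻¹ ^ q * (√(2 * Real.pi * v))⁻¹ ^ q =
      (√(2 * Real.pi * v * a ^ 3))⁻¹ ^ q := by
    have : √(a ^ 3) = a * √a := by
      rw [pow_succ, Real.sqrt_mul (by positivity), Real.sqrt_sq ha.le]
    rw [one_mul, ← mul_pow, ← mul_inv,
      Real.sqrt_mul (by positivity : 0 ≤ 2 * Real.pi * v), this, mul_comm]
  rw [hlim] at h1
  refine h1.congr fun κ => ?_
  have hmκ : (0 : ℝ) < m κ := by exact_mod_cast Nat.pos_of_ne_zero (NeZero.ne (m κ))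
  have hNκ : (0 : ℝ) < N κ := by exact_mod_cast Nat.pos_of_ne_zero (NeZero.ne (N κ))
  have h2 : (m κ : ℝ) ^ q * ∑ σ : Equiv.Perm (ZMod (N κ)),
      ((cyclicCount (m κ) (x κ ∘ σ)).descFactorial q : ℝ) =
      (Finset.univ.filter fun e : Fin q → ZMod (N κ) =>
        Function.Injective (windowPos (m κ) e)).card *
        (blockCount (x κ) (m κ) q Finset.univ * (N κ - q * m κ).factorial) := by
    exact_mod_cast sum_descFactorial_cyclicCount (hmN κ) (x κ) q
  rw [Fintype.card_perm, Finset.card_univ, ZMod.card]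
  have h3 : ((N κ).factorial : ℝ) ≠ 0 := by positivity
  rw [eq_div_iff h3]
  refine mul_left_cancel₀ (pow_pos hmκ q).ne' (Eq.trans ?_ h2.symm)
  have h4 : √(m κ : ℝ) ≠ 0 := by positivity
  rw [div_pow, mul_pow]
  field_simp

/-- Theorem 6.2: Poisson limit for the number of fringe trees of size `∼ a |n_κ|^{2/3}`. -/
theorem countSize_poisson
    (nseq : ℕ → (ℕ →₀ ℕ)) (p : ℕ → ℝ) (m : ℕ → ℕ) (a : ℝ)
    (hcond1 : Condition1 nseq p) (hcond2 : Condition2 nseq p) (hnl : Nonlattice p)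
    (hm : ∀ κ, 1 ≤ m κ ∧ m κ ≤ nsize (nseq κ))
    (ha : 0 < a)
    (hmsim : Tendsto (fun κ => (m κ : ℝ) / (nsize (nseq κ) : ℝ) ^ ((2 : ℝ) / 3))
      atTop (𝓝 a)) :
    ∀ k : ℕ, Tendsto
      (fun κ => prob (nseq κ) (fun T => PlaneTree.countSize (m κ) T = k))
      atTop (𝓝 (poissonPMF ((Real.sqrt (2 * Real.pi * sigmaSq p * a ^ 3))⁻¹) k)) := by
  have hr0 := tendsto_div_zero_of_div_rpow hcond1.2.1 hmsim
  have hpos := hnl.sigmaSq_pos hcond1 hcond2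
  have hm0 := tendsto_atTop_of_div_rpow hcond1.2.1 hmsim ha
  have hs := tendsto_div_mul_sqrt_of_div_rpow hcond1.2.1 hmsim ha
  have : ∀ κ, NeZero (m κ) := fun κ => ⟨by have := hm κ; omega⟩
  have : ∀ κ, NeZero (nsize (nseq κ)) := fun κ => ⟨by have := hm κ; omega⟩
  have hcard : ∀ κ, Fintype.card (ZMod (nsize (nseq κ))) = nsize (nseq κ) := fun κ => ZMod.card _
  have hd : ∀ κ, ∃ d : ZMod (nsize (nseq κ)) → ℕ,
      Finset.univ.val.map d = Finsupp.toMultiset (nseq κ) := fun κ =>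
    Multiset.exists_map_univ_eq _ (by rw [Finsupp.card_toMultiset, hcard]; rfl)
  choose d hd using hd
  obtain ⟨F, hFp, hF⟩ := hnl.exists_finset_spreads
  have hreg := regularPopulation_of_conditions hcond1 hcond2 hm0 hr0 hFp hcard hd
  intro k
  refine (tendsto_poisson_of_factorial_moments
    (fun κ (σ : Equiv.Perm (ZMod (nsize (nseq κ)))) =>
      cyclicCount (m κ) ((fun i => (d κ i : ℤ) - 1) ∘ σ)) _ (fun q =>
    tendsto_factorialMoment_cyclicCount (fun κ => (hm κ).2) ha hpos hs hF hreg q) k).congr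
    fun κ => ?_
  rw [PlaneTree.prob_countSize_eq (nseq κ) (d κ) (hd κ) ((hcond1.1 κ).sum_sub_one (hd κ))]
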